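/- arXiv:2601.01553 — 4 statements merged into one kernel-verified Lean document; each statement's English description precedes it below -/
import Mathlib

section
/- Let f : ℂ×ℂ → ℂ be analytic on a neighborhood of (0,0) and let u be a Weierstrass polynomial of degree m analytic on a neighborhood of (0,0). Then there exist a neighborhood U of (0,0) and functions g, r analytic on U such that for each p, the function z ↦ r(z,p) is a polynomial in z of degree less than m, and f(z,p) = g(z,p)·u(z,p) + r(z,p) for all (z,p) ∈ U. Moreover g and r are unique in the sense that any two such pairs agree on a common neighborhood of (0,0). -/
/-- The monic degree-`m` polynomial in `z` with coefficients `α j p`. -/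
noncomputable def wpoly (m : ℕ) (α : ℕ → ℂ → ℂ) (z p : ℂ) : ℂ :=
  z ^ m + ∑ j ∈ Finset.range m, α j p * z ^ j

/-- `r` is a polynomial function of degree at most `m - 1`. -/
def PolyDegLt (r : ℂ → ℂ) (m : ℕ) : Prop :=
  ∃ q : Polynomial ℂ, q.degree < (m : WithBot ℕ) ∧ ∀ z, r z = q.eval z

/-- `(Ω', P', g, r)` is a Weierstrass division of `f` by `u` near `(0,0)`:
`f = g·u + r` on `Ω' × P'` with `g, r` analytic on `Ω' × P'` and, for each `p ∈ P'`,
`z ↦ r(z,p)` a polynomial in `z` of degree less than `m`. -/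
def IsWDiv (f u : ℂ → ℂ → ℂ) (m : ℕ) (Ω' P' : Set ℂ) (g r : ℂ → ℂ → ℂ) : Prop :=
  IsOpen Ω' ∧ IsOpen P' ∧ (0 : ℂ) ∈ Ω' ∧ (0 : ℂ) ∈ P' ∧
  AnalyticOnNhd ℂ (fun q : ℂ × ℂ => g q.1 q.2) (Ω' ×ˢ P') ∧
  AnalyticOnNhd ℂ (fun q : ℂ × ℂ => r q.1 q.2) (Ω' ×ˢ P') ∧
  (∀ p ∈ P', PolyDegLt (fun z => r z p) m) ∧
  ∀ z ∈ Ω', ∀ p ∈ P', f z p = g z p * u z p + r z p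

open Metric Filter Topology

lemma wpoly_ne (m : ℕ) (Pdom : Set ℂ) (hP0 : (0:ℂ) ∈ Pdom)
    (α : ℕ → ℂ → ℂ) (hα : ∀ j < m, AnalyticOnNhd ℂ (α j) Pdom ∧ α j 0 = 0)
    (R : ℝ) (hR : 0 < R) :
    ∀ᶠ p in 𝓝 (0:ℂ), ∀ z : ℂ, R ≤ ‖z‖ → wpoly m α z p ≠ 0 := by
  have hc : ContinuousAt (fun p => ∑ j ∈ Finset.range m, ‖α j p‖ * R ^ j) 0 := by
    refine tendsto_finsetSum _ fun j hj => ?_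
    have := ((hα j (Finset.mem_range.1 hj)).1 0 hP0).continuousAt
    exact (this.norm.mul continuousAt_const)
  have h0 : (∑ j ∈ Finset.range m, ‖α j 0‖ * R ^ j) < R ^ m := by
    rw [Finset.sum_eq_zero]
    · positivity
    · intro j hj
      simp [(hα j (Finset.mem_range.1 hj)).2]
  filter_upwards [hc.eventually_lt continuousAt_const h0] with p hp z hz h
  have h1 : z ^ m = - ∑ j ∈ Finset.range m, α j p * z ^ j := by
    rw [wpoly] at h; exact eq_neg_of_add_eq_zero_left h
  obtain ⟨t, ht, htz⟩ : ∃ t : ℝ, 1 ≤ t ∧ ‖z‖ = t * R :=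
    ⟨‖z‖ / R, (one_le_div hR).2 hz, by field_simp⟩
  have h2 : ‖z‖ ^ m ≤ ∑ j ∈ Finset.range m, ‖α j p‖ * ‖z‖ ^ j := by
    rw [← norm_pow, h1, norm_neg]
    refine (norm_sum_le _ _).trans_eq ?_
    simp
  have h3 : ∑ j ∈ Finset.range m, ‖α j p‖ * ‖z‖ ^ j ≤
      t ^ m * ∑ j ∈ Finset.range m, ‖α j p‖ * R ^ j := by
    rw [Finset.mul_sum]
    refine Finset.sum_le_sum fun j hj => ?_
    have : t ^ j ≤ t ^ m := pow_le_pow_right₀ ht (Finset.mem_range.1 hj).le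
    rw [htz, mul_pow]
    calc ‖α j p‖ * (t ^ j * R ^ j) = t ^ j * (‖α j p‖ * R ^ j) := by ring
      _ ≤ _ := by gcongr
  have h4 : t ^ m * ∑ j ∈ Finset.range m, ‖α j p‖ * R ^ j < t ^ m * R ^ m := by
    have : 0 < t ^ m := by positivity
    gcongr
  rw [htz] at h2 h3
  rw [mul_pow] at h2
  linarith

/-- divisibility lemma -/
lemma prod_dvd (s : Multiset ℂ) : ∀ (U : Set ℂ) (_ : IsOpen U) (G : ℂ → ℂ)
    (_ : ContinuousOn G U) (q : Polynomial ℂ) (_ : ∀ a ∈ s, a ∈ U)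
    (_ : ∀ z ∈ U, q.eval z = G z * (s.map fun a => Polynomial.X - Polynomial.C a).prod.eval z),
    (s.map fun a => Polynomial.X - Polynomial.C a).prod ∣ q := by
  induction s using Multiset.induction_on with
  | empty => intros; simp
  | cons a s ih =>
    intro U hU G hG q hs hq
    have ha : a ∈ U := hs a (Multiset.mem_cons_self _ _)
    have h0 : q.IsRoot a := by
      have := hq a ha
      simpa using this
    obtain ⟨q', rfl⟩ := Polynomial.dvd_iff_isRoot.2 h0
    rw [Multiset.map_cons, Multiset.prod_cons]
    refine mul_dvd_mul_left _ (ih U hU G hG q' (fun b hb => hs b (Multiset.mem_cons_of_mem hb)) ?_)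
    have key : ∀ z ∈ U, z ≠ a → q'.eval z = G z * (s.map fun a => Polynomial.X - Polynomial.C a).prod.eval z := by
      intro z hz hza
      have := hq z hz
      rw [Multiset.map_cons, Multiset.prod_cons, Polynomial.eval_mul, Polynomial.eval_mul] at this
      simp only [Polynomial.eval_sub, Polynomial.eval_X, Polynomial.eval_C] at this
      have h : z - a ≠ 0 := sub_ne_zero.2 hza
      apply mul_left_cancel₀ h
      rw [this]; ring
    intro z hz
    by_cases hza : z = a
    · subst hza
      have h1 : Tendsto (fun z => q'.eval z) (𝓝[≠] z) (𝓝 (q'.eval z)) :=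
        q'.continuous.continuousAt.mono_left nhdsWithin_le_nhds
      have h2 : Tendsto (fun z => G z * (s.map fun a => Polynomial.X - Polynomial.C a).prod.eval z) (𝓝[≠] z)
          (𝓝 (G z * (s.map fun a => Polynomial.X - Polynomial.C a).prod.eval z)) :=
        ((hG.continuousAt (hU.mem_nhds hz)).mul
          (Polynomial.continuous _).continuousAt).mono_left nhdsWithin_le_nhds
      refine tendsto_nhds_unique (h1.congr' ?_) h2
      filter_upwards [self_mem_nhdsWithin, nhdsWithin_le_nhds (hU.mem_nhds hz)] with w hw hwU
      exact key w hwU hw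
    · exact key z hz hza

/-- one variable uniqueness -/
lemma uniq_one (U : Set ℂ) (hU : IsOpen U) (G : ℂ → ℂ) (hG : ContinuousOn G U)
    (u q : Polynomial ℂ) (hu : u.Monic) (hq : q.degree < u.degree) (hr : ∀ a, u.eval a = 0 → a ∈ U)
    (h : ∀ z ∈ U, q.eval z = G z * u.eval z) : q = 0 ∧ ∀ z ∈ U, G z = 0 := by
  have hsp : u = (u.roots.map fun a => Polynomial.X - Polynomial.C a).prod :=
    (IsAlgClosed.splits u).eq_prod_roots_of_monic hu
  have hd : u ∣ q := by
    have := prod_dvd u.roots U hU G hG q (fun a ha => hr a (Polynomial.isRoot_of_mem_roots ha)) 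
      (by rw [← hsp]; exact h)
    rwa [← hsp] at this
  have hq0 : q = 0 := Polynomial.eq_zero_of_dvd_of_degree_lt hd hq
  refine ⟨hq0, fun z hz => ?_⟩
  have hfin : {w | u.eval w = 0}.Finite := by
    refine (u.roots.toFinset.finite_toSet).subset fun w hw => ?_
    simp [hu.ne_zero, hw.out] 
  have h1 : Tendsto G (𝓝[≠] z) (𝓝 (G z)) :=
    (hG.continuousAt (hU.mem_nhds hz)).mono_left nhdsWithin_le_nhds
  refine tendsto_nhds_unique h1 (tendsto_const_nhds.congr' ?_)
  have h2 : ∀ᶠ w in 𝓝[≠] z, u.eval w ≠ 0 := by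
    have := (hfin.subset (Set.sdiff_subset (t := {z}))).isClosed.isOpen_compl.mem_nhds (x := z) (by simp)
    filter_upwards [self_mem_nhdsWithin, nhdsWithin_le_nhds this] with w hw hw2 h3
    exact hw2 ⟨h3, hw⟩
  filter_upwards [h2, nhdsWithin_le_nhds (hU.mem_nhds hz)] with w hw hwU
  have := h w hwU
  rw [hq0, Polynomial.eval_zero] at this
  exact (mul_eq_zero.1 this.symm).resolve_right hw |>.symm

open Complex Real in
/-- The Cauchy functional on continuous functions on a circle. -/
lemma exists_functional (R : ℝ) (hR : 0 < R) :
    ∃ L : C(sphere (0:ℂ) R, ℂ) →L[ℂ] ℂ, ∀ (φ : C(sphere (0:ℂ) R, ℂ)) (F : ℂ → ℂ),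
      (∀ ζ : sphere (0:ℂ) R, φ ζ = F ζ) → L φ = (2 * π * I : ℂ)⁻¹ • ∮ ζ in C(0, R), F ζ := by
  let c : C(ℝ, sphere (0:ℂ) R) :=
    ⟨fun θ => ⟨circleMap 0 R θ, circleMap_mem_sphere 0 hR.le θ⟩, by fun_prop⟩
  have hint : ∀ φ : C(sphere (0:ℂ) R, ℂ), Continuous fun θ => deriv (circleMap 0 R) θ * φ (c θ) := by
    intro φ
    simp only [deriv_circleMap]
    fun_prop
  let L0 : C(sphere (0:ℂ) R, ℂ) →ₗ[ℂ] ℂ :=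
    { toFun := fun φ => ∫ θ in (0:ℝ)..2 * π, deriv (circleMap 0 R) θ * φ (c θ)
      map_add' := by
        intro φ ψ
        rw [← intervalIntegral.integral_add ((hint φ).intervalIntegrable _ _)
          ((hint ψ).intervalIntegrable _ _)]
        simp [mul_add]
      map_smul' := by
        intro a φ
        simp only [RingHom.id_apply, smul_eq_mul]
        rw [← intervalIntegral.integral_const_mul]
        congr 1
        ext θ
        simp; ring }
  let L1 : C(sphere (0:ℂ) R, ℂ) →L[ℂ] ℂ := L0.mkContinuous (R * |2 * π - 0|) (by
    intro φ
    have := intervalIntegral.norm_integral_le_of_norm_le_const (a := (0:ℝ)) (b := 2 * π)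
      (f := fun θ => deriv (circleMap 0 R) θ * φ (c θ)) (C := R * ‖φ‖) (by
        intro θ _
        rw [norm_mul]
        have h1 : ‖deriv (circleMap 0 R) θ‖ = R := by simp [abs_of_pos hR]
        rw [h1]
        gcongr
        exact φ.norm_coe_le_norm _)
    refine this.trans_eq (by ring))
  refine ⟨(2 * π * I : ℂ)⁻¹ • L1, fun φ F h => ?_⟩
  show (2 * π * I : ℂ)⁻¹ • (∫ θ in (0:ℝ)..2 * π, deriv (circleMap 0 R) θ * φ (c θ)) = _
  simp only [circleIntegral, h]
  rfl

open Complex Real in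
/-- A function continuous in both variables, holomorphic in the second, gives an analytic
curve in the space of continuous functions. -/
lemma exists_curve (R s : ℝ) (hs : 0 < s) (F : ℂ → ℂ → ℂ)
    (hc : ContinuousOn (fun q : ℂ × ℂ => F q.1 q.2) (sphere (0:ℂ) R ×ˢ closedBall (0:ℂ) s))
    (hd : ∀ ζ ∈ sphere (0:ℂ) R, ∀ p ∈ ball (0:ℂ) s, DifferentiableAt ℂ (F ζ) p) :
    ∃ H : ℂ → C(sphere (0:ℂ) R, ℂ), AnalyticOnNhd ℂ H (ball 0 s) ∧
      ∀ p ∈ ball (0:ℂ) s, ∀ ζ : sphere (0:ℂ) R, H p ζ = F ζ p := by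
  classical
  let Ψ : C(closedBall (0:ℂ) s, C(sphere (0:ℂ) R, ℂ)) :=
    ContinuousMap.curry ⟨fun q => F q.2 q.1, by
      have := hc.comp_continuous (f := fun q : closedBall (0:ℂ) s × sphere (0:ℂ) R =>
        ((q.2 : ℂ), (q.1 : ℂ))) (by fun_prop) (fun q => ⟨q.2.2, q.1.2⟩)
      exact this⟩
  let Φ : ℂ → C(sphere (0:ℂ) R, ℂ) := fun w => if h : w ∈ closedBall (0:ℂ) s then Ψ ⟨w, h⟩ else 0
  have hΦ : ContinuousOn Φ (closedBall 0 s) := by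
    rw [continuousOn_iff_continuous_domRestrict]
    refine Ψ.continuous.congr fun w => ?_
    simp only [Set.domRestrict_apply, Φ]
    rw [dif_pos w.2]
  have hΦv : ∀ w ∈ closedBall (0:ℂ) s, ∀ ζ : sphere (0:ℂ) R, Φ w ζ = F ζ w := by
    intro w hw ζ
    simp only [Φ]
    rw [dif_pos hw]
    rfl
  lift s to NNReal using hs.le
  have hci : CircleIntegrable Φ 0 s := (hΦ.mono sphere_subset_closedBall).circleIntegrable hs.le
  have hps := hasFPowerSeriesOn_cauchy_integral hci (by exact_mod_cast hs)
  have hpa := hps.analyticOnNhd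
  rw [Metric.eball_coe] at hpa
  refine ⟨_, hpa, fun p hp ζ => ?_⟩
  have h2 := Complex.two_pi_I_inv_smul_circleIntegral_sub_inv_smul_of_differentiable_on_off_countable
    (f := F ζ) (R := s) (c := 0) (w := p) Set.countable_empty hp
    (hc.comp (f := fun w => ((ζ:ℂ), w)) (by fun_prop) (fun w hw => ⟨ζ.2, hw⟩))
    (fun x hx => hd ζ ζ.2 x hx.1)
  rw [← h2]
  have hi2 : CircleIntegrable (fun w => (w - p)⁻¹ • Φ w) 0 s := by
    refine ContinuousOn.circleIntegrable hs.le ?_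
    refine ContinuousOn.smul (ContinuousOn.inv₀ (f := fun w : ℂ => w - p) (by fun_prop) ?_) (hΦ.mono sphere_subset_closedBall)
    intro w hw h
    rw [sub_eq_zero.1 h] at hw
    simp at hw hp
    linarith
  have h3 := (ContinuousMap.evalCLM ℂ ζ : C(sphere (0:ℂ) R, ℂ) →L[ℂ] ℂ).intervalIntegral_comp_comm hi2.out
  rw [ContinuousMap.smul_apply]
  congr 1
  refine h3.symm.trans ?_
  refine circleIntegral.integral_congr (f := fun w => ((w - p)⁻¹ • Φ w) ζ) hs.le fun w hw => ?_
  simp [hΦv w (sphere_subset_closedBall hw) ζ]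

/-- the polynomial associated with `wpoly` -/
lemma wpoly_eval (m : ℕ) (α : ℕ → ℂ → ℂ) (p : ℂ) :
    ∃ u : Polynomial ℂ, u.Monic ∧ u.degree = m ∧ ∀ z, u.eval z = wpoly m α z p := by
  have hlt : (∑ j ∈ Finset.range m, Polynomial.C (α j p) * Polynomial.X ^ j).degree < (m : WithBot ℕ) := by
    rw [← Polynomial.mem_degreeLT]
    refine Submodule.sum_mem _ fun j hj => ?_
    rw [Polynomial.mem_degreeLT]
    exact (Polynomial.degree_C_mul_X_pow_le _ _).trans_lt (by exact_mod_cast Finset.mem_range.1 hj)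
  refine ⟨Polynomial.X ^ m + ∑ j ∈ Finset.range m, Polynomial.C (α j p) * Polynomial.X ^ j,
    Polynomial.monic_X_pow_add hlt, ?_, ?_⟩
  · rw [Polynomial.degree_add_eq_left_of_degree_lt (by simpa using hlt)]; simp
  · intro z
    simp [wpoly, Polynomial.eval_finsetSum]

lemma polyDegLt_sum (m : ℕ) (c : ℕ → ℕ → ℂ) (a : ℕ → ℂ) :
    PolyDegLt (fun z => ∑ i ∈ Finset.range m, c m i * z ^ (m - 1 - i) +
      ∑ j ∈ Finset.range m, a j * ∑ i ∈ Finset.range j, c j i * z ^ (j - 1 - i)) m := by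
  refine ⟨∑ i ∈ Finset.range m, Polynomial.C (c m i) * Polynomial.X ^ (m - 1 - i) +
      ∑ j ∈ Finset.range m, Polynomial.C (a j) *
        ∑ i ∈ Finset.range j, Polynomial.C (c j i) * Polynomial.X ^ (j - 1 - i), ?_, ?_⟩
  · have key : ∀ j ≤ m, ∑ i ∈ Finset.range j, Polynomial.C (c j i) * Polynomial.X ^ (j - 1 - i)
        ∈ Polynomial.degreeLT ℂ m := by
      intro j hj
      refine Submodule.sum_mem _ fun i hi => ?_
      rw [Polynomial.mem_degreeLT]
      refine (Polynomial.degree_C_mul_X_pow_le _ _).trans_lt ?_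
      have := Finset.mem_range.1 hi
      exact_mod_cast (by omega : j - 1 - i < m)
    rw [← Polynomial.mem_degreeLT]
    refine Submodule.add_mem _ (key m le_rfl) (Submodule.sum_mem _ fun j hj => ?_)
    rw [← Polynomial.smul_eq_C_mul]
    exact Submodule.smul_mem _ _ (key j (Finset.mem_range.1 hj).le)
  · intro z
    simp [Polynomial.eval_finsetSum]

lemma wdiv_unique
    (m : ℕ) (Pdom : Set ℂ) (hP0 : (0 : ℂ) ∈ Pdom)
    (f : ℂ → ℂ → ℂ) (α : ℕ → ℂ → ℂ)
    (hα : ∀ j < m, AnalyticOnNhd ℂ (α j) Pdom ∧ α j 0 = 0)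
    (Ω₁ P₁ : Set ℂ) (g₁ r₁ : ℂ → ℂ → ℂ) (Ω₂ P₂ : Set ℂ) (g₂ r₂ : ℂ → ℂ → ℂ)
    (h₁ : IsWDiv f (wpoly m α) m Ω₁ P₁ g₁ r₁) (h₂ : IsWDiv f (wpoly m α) m Ω₂ P₂ g₂ r₂) :
      ∃ Ω₃ P₃ : Set ℂ, IsOpen Ω₃ ∧ IsOpen P₃ ∧ (0 : ℂ) ∈ Ω₃ ∧ (0 : ℂ) ∈ P₃ ∧
        ∀ z ∈ Ω₃, ∀ p ∈ P₃, g₁ z p = g₂ z p ∧ r₁ z p = r₂ z p := by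
  obtain ⟨hO1, hP1, hO10, hP10, hg1, hr1, hp1, he1⟩ := h₁
  obtain ⟨hO2, hP2, hO20, hP20, hg2, hr2, hp2, he2⟩ := h₂
  obtain ⟨R, hR, hRs⟩ := Metric.isOpen_iff.1 (hO1.inter hO2) 0 ⟨hO10, hO20⟩
  have hev := (wpoly_ne m Pdom hP0 α hα R hR).and ((hP1.inter hP2).mem_nhds ⟨hP10, hP20⟩)
  obtain ⟨s, hs, hss⟩ := Metric.eventually_nhds_iff_ball.1 hev
  refine ⟨ball 0 R, ball 0 s, isOpen_ball, isOpen_ball, mem_ball_self hR, mem_ball_self hs, ?_⟩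
  intro z hz p hp
  obtain ⟨hu, hpP1, hpP2⟩ := hss p hp
  obtain ⟨u, hum, hud, hue⟩ := wpoly_eval m α p
  obtain ⟨q1, hq1, hq1e⟩ := hp1 p hpP1
  obtain ⟨q2, hq2, hq2e⟩ := hp2 p hpP2
  have hG : ContinuousOn (fun z => g₁ z p - g₂ z p) (ball 0 R) := by
    refine ContinuousOn.sub ?_ ?_
    · exact hg1.continuousOn.comp (f := fun z => (z, p)) (by fun_prop) fun z hz => ⟨(hRs hz).1, hpP1⟩
    · exact hg2.continuousOn.comp (f := fun z => (z, p)) (by fun_prop) fun z hz => ⟨(hRs hz).2, hpP2⟩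
  have := uniq_one (ball 0 R) isOpen_ball _ hG u (q2 - q1) hum
    ((Polynomial.degree_sub_le _ _).trans_lt (by rw [hud]; exact max_lt hq2 hq1)) (by
      intro a ha
      by_contra hna
      rw [hue] at ha
      exact hu a (by simpa using hna) ha) (by
      intro z hz
      have e1 := he1 z (hRs hz).1 p hpP1
      have e2 := he2 z (hRs hz).2 p hpP2
      rw [Polynomial.eval_sub, ← hq1e, ← hq2e, hue]
      linear_combination e1 - e2)
  refine ⟨sub_eq_zero.1 (this.2 z hz), ?_⟩
  have h1 := hq1e z
  have h2 := hq2e z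
  simp only at h1 h2
  rw [h1, h2, sub_eq_zero.1 this.1]

lemma wdiv_exists
    (m : ℕ) (Ω Pdom : Set ℂ) (hΩo : IsOpen Ω) (hPo : IsOpen Pdom)
    (hΩ0 : (0 : ℂ) ∈ Ω) (hP0 : (0 : ℂ) ∈ Pdom)
    (f : ℂ → ℂ → ℂ)
    (hf : AnalyticOnNhd ℂ (fun q : ℂ × ℂ => f q.1 q.2) (Ω ×ˢ Pdom))
    (α : ℕ → ℂ → ℂ)
    (hα : ∀ j < m, AnalyticOnNhd ℂ (α j) Pdom ∧ α j 0 = 0) :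
    ∃ Ω' P' g r, Ω' ⊆ Ω ∧ P' ⊆ Pdom ∧ IsWDiv f (wpoly m α) m Ω' P' g r := by
  obtain ⟨R, hR, hRs⟩ := Metric.nhds_basis_closedBall.mem_iff.1 (hΩo.mem_nhds hΩ0)
  have hev := (wpoly_ne m Pdom hP0 α hα R hR).and (hPo.mem_nhds hP0)
  obtain ⟨s, hs, hss⟩ := Metric.nhds_basis_closedBall.eventually_iff.1 hev
  obtain ⟨L, hL⟩ := exists_functional R hR
  have hsP : closedBall (0:ℂ) s ⊆ Pdom := fun p hp => (hss hp).2
  have hu : AnalyticOnNhd ℂ (fun q : ℂ × ℂ => wpoly m α q.1 q.2) (Set.univ ×ˢ Pdom) := by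
    intro q hq
    unfold wpoly
    refine (analyticAt_fst.pow m).add (Finset.analyticAt_fun_sum _ fun j hj => ?_)
    exact (((hα j (Finset.mem_range.1 hj)).1 q.2 hq.2).comp analyticAt_snd).mul (analyticAt_fst.pow j)
  have hune : ∀ ζ ∈ sphere (0:ℂ) R, ∀ p ∈ closedBall (0:ℂ) s, wpoly m α ζ p ≠ 0 :=
    fun ζ hζ p hp => (hss hp).1 ζ (by simpa using hζ.ge)
  have hfu : AnalyticOnNhd ℂ (fun q : ℂ × ℂ => f q.1 q.2 / wpoly m α q.1 q.2)
      (sphere (0:ℂ) R ×ˢ closedBall (0:ℂ) s) := by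
    intro q hq
    exact (hf q ⟨hRs (sphere_subset_closedBall hq.1), hsP hq.2⟩).div (hu q ⟨trivial, hsP hq.2⟩)
      (hune _ hq.1 _ hq.2)
  obtain ⟨h, hha, hhv⟩ := exists_curve R s hs (fun ζ p => f ζ p / wpoly m α ζ p) hfu.continuousOn (by
    intro ζ hζ p hp
    have := (hfu (ζ, p) ⟨hζ, ball_subset_closedBall hp⟩).differentiableAt
    exact this.comp (f := fun p => (ζ, p)) p (by fun_prop))
  have hne : ∀ ζ ∈ sphere (0:ℂ) R, ∀ p ∈ closedBall (0:ℂ) (R/2), ζ - p ≠ 0 := by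
    intro ζ hζ p hp h0
    rw [sub_eq_zero] at h0
    subst h0
    simp at hζ hp
    linarith
  obtain ⟨k, hka, hkv⟩ := exists_curve R (R/2) (by positivity) (fun ζ z => (ζ - z)⁻¹)
    (ContinuousOn.inv₀ (by fun_prop) fun q hq => hne _ hq.1 _ hq.2)
    (fun ζ hζ p hp => DifferentiableAt.inv (by fun_prop) (hne _ hζ _ (ball_subset_closedBall hp)))
  let e : C(sphere (0:ℂ) R, ℂ) := ⟨fun ζ => ζ, by fun_prop⟩
  have hev : ∀ ζ, e ζ = ζ := fun _ => rfl
  have hhA : AnalyticOnNhd ℂ (fun q : ℂ × ℂ => h q.2) (ball (0:ℂ) (R/2) ×ˢ ball (0:ℂ) s) :=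
    fun q hq => (hha q.2 hq.2).comp analyticAt_snd
  have hkA : AnalyticOnNhd ℂ (fun q : ℂ × ℂ => k q.1) (ball (0:ℂ) (R/2) ×ˢ ball (0:ℂ) s) :=
    fun q hq => (hka q.1 hq.1).comp analyticAt_fst
  have hLA : ∀ (φ : ℂ × ℂ → C(sphere (0:ℂ) R, ℂ)) (q : ℂ × ℂ), AnalyticAt ℂ φ q →
      AnalyticAt ℂ (fun q => L (φ q)) q := fun φ q hφ => (L.analyticAt _).comp hφ
  have hDA : ∀ j, AnalyticOnNhd ℂ (fun q : ℂ × ℂ => ∑ i ∈ Finset.range j,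
      L (h q.2 * e ^ i) * q.1 ^ (j - 1 - i)) (ball (0:ℂ) (R/2) ×ˢ ball (0:ℂ) s) := by
    intro j q hq
    refine Finset.analyticAt_fun_sum _ fun i _ => ?_
    exact (hLA _ q ((hhA q hq).mul analyticAt_const)).mul (analyticAt_fst.pow _)
  refine ⟨ball 0 (R/2), ball 0 s, fun z p => L (h p * k z),
    fun z p => ∑ i ∈ Finset.range m, L (h p * e ^ i) * z ^ (m - 1 - i) +
      ∑ j ∈ Finset.range m, α j p * ∑ i ∈ Finset.range j, L (h p * e ^ i) * z ^ (j - 1 - i),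
    fun z hz => hRs (ball_subset_closedBall (ball_subset_ball (by linarith) hz)),
    fun p hp => hsP (ball_subset_closedBall hp), isOpen_ball, isOpen_ball,
    mem_ball_self (by positivity), mem_ball_self hs, ?_, ?_, ?_, ?_⟩
  · exact fun q hq => hLA _ q ((hhA q hq).mul (hkA q hq))
  · intro q hq
    refine (hDA m q hq).add (Finset.analyticAt_fun_sum _ fun j hj => ?_)
    exact (((hα j (Finset.mem_range.1 hj)).1 q.2 (hsP (ball_subset_closedBall hq.2))).comp
      analyticAt_snd).mul (hDA j q hq)
  · exact fun p hp => polyDegLt_sum m (fun _ i => L (h p * e ^ i)) (fun j => α j p)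
  · intro z hz p hp
    have hD : ∀ j, ∑ i ∈ Finset.range j, L (h p * e ^ i) * z ^ (j - 1 - i) =
        L (h p * k z * e ^ j) - L (h p * k z) * z ^ j := by
      intro j
      have h1 : h p * k z * e ^ j - z ^ j • (h p * k z) =
          ∑ i ∈ Finset.range j, z ^ (j - 1 - i) • (h p * e ^ i) := by
        ext ζ
        have h2 := (Commute.all (ζ:ℂ) z).geom_sum₂_mul j
        have h3 := hne ζ ζ.2 z (ball_subset_closedBall hz)
        simp only [ContinuousMap.sub_apply, ContinuousMap.mul_apply, ContinuousMap.smul_apply,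
          ContinuousMap.pow_apply, ContinuousMap.sum_apply, hev, hkv z hz, smul_eq_mul]
        calc _ = h p ζ * (ζ - z)⁻¹ * ((ζ:ℂ) ^ j - z ^ j) := by ring
          _ = h p ζ * ∑ i ∈ Finset.range j, (ζ:ℂ) ^ i * z ^ (j - 1 - i) := by
            rw [← h2]; field_simp
          _ = _ := by
            rw [Finset.mul_sum]
            exact Finset.sum_congr rfl fun i _ => by ring
      have h4 := congrArg L h1
      rw [map_sub, map_sum, map_smul, smul_eq_mul] at h4
      rw [mul_comm (L (h p * k z)), h4]
      refine Finset.sum_congr rfl fun i _ => ?_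
      rw [map_smul, smul_eq_mul, mul_comm]
    have hC : L (h p * k z * e ^ m) + ∑ j ∈ Finset.range m, α j p * L (h p * k z * e ^ j) = f z p := by
      have h1 : L (h p * k z * e ^ m) + ∑ j ∈ Finset.range m, α j p * L (h p * k z * e ^ j) =
          L (h p * k z * e ^ m + ∑ j ∈ Finset.range m, α j p • (h p * k z * e ^ j)) := by
        simp [map_add, map_sum, map_smul]
      rw [h1, hL _ (fun ζ => (ζ - z)⁻¹ • f ζ p)]
      · refine Complex.two_pi_I_inv_smul_circleIntegral_sub_inv_smul_of_differentiable_on_off_countable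
          (f := fun ζ => f ζ p) (R := R) (c := 0) (w := z) Set.countable_empty
          (ball_subset_ball (by linarith) hz) ?_ ?_
        · exact hf.continuousOn.comp (f := fun z => (z, p)) (by fun_prop)
            fun z hz => ⟨hRs hz, hsP (ball_subset_closedBall hp)⟩
        · intro x hx
          have := (hf (x, p) ⟨hRs (ball_subset_closedBall hx.1),
            hsP (ball_subset_closedBall hp)⟩).differentiableAt
          exact this.comp (f := fun z => (z, p)) x (by fun_prop)
      · intro ζ
        have h5 := hune ζ ζ.2 p (ball_subset_closedBall hp)
        simp only [ContinuousMap.add_apply, ContinuousMap.mul_apply, ContinuousMap.smul_apply,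
          ContinuousMap.pow_apply, ContinuousMap.sum_apply, hev, hkv z hz, hhv p hp, smul_eq_mul]
        calc _ = f ζ p / wpoly m α ζ p * (ζ - z)⁻¹ * ((ζ:ℂ) ^ m + ∑ j ∈ Finset.range m, α j p * (ζ:ℂ) ^ j) := by
              rw [mul_add, Finset.mul_sum]
              congr 1
              exact Finset.sum_congr rfl fun i _ => by ring
          _ = f ζ p / wpoly m α ζ p * (ζ - z)⁻¹ * wpoly m α ζ p := rfl
          _ = _ := by rw [mul_right_comm, div_mul_cancel₀ _ h5, mul_comm]
    simp only [hD, wpoly]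
    rw [← hC]
    simp only [mul_sub, Finset.sum_sub_distrib, mul_add, Finset.mul_sum]
    have : ∀ j, α j p * (L (h p * k z) * z ^ j) = L (h p * k z) * (α j p * z ^ j) := fun j => by ring
    simp only [this]
    ring

/-- **Weierstrass division theorem** in two complex variables (Theorem B.7): division of
an analytic `f` by a Weierstrass polynomial `u` of degree `m` near `(0,0)`, with the
quotient and remainder unique in the sense that any two such pairs agree on a common
neighborhood of `(0,0)`. -/
theorem weierstrass_division
    (m : ℕ) (Ω Pdom : Set ℂ) (hΩo : IsOpen Ω) (hPo : IsOpen Pdom)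
    (hΩ0 : (0 : ℂ) ∈ Ω) (hP0 : (0 : ℂ) ∈ Pdom)
    (f : ℂ → ℂ → ℂ)
    (hf : AnalyticOnNhd ℂ (fun q : ℂ × ℂ => f q.1 q.2) (Ω ×ˢ Pdom))
    (α : ℕ → ℂ → ℂ)
    (hα : ∀ j < m, AnalyticOnNhd ℂ (α j) Pdom ∧ α j 0 = 0) :
    (∃ Ω' P' g r, Ω' ⊆ Ω ∧ P' ⊆ Pdom ∧ IsWDiv f (wpoly m α) m Ω' P' g r) ∧
    ∀ Ω₁ P₁ g₁ r₁ Ω₂ P₂ g₂ r₂,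
      IsWDiv f (wpoly m α) m Ω₁ P₁ g₁ r₁ → IsWDiv f (wpoly m α) m Ω₂ P₂ g₂ r₂ →
      ∃ Ω₃ P₃ : Set ℂ, IsOpen Ω₃ ∧ IsOpen P₃ ∧ (0 : ℂ) ∈ Ω₃ ∧ (0 : ℂ) ∈ P₃ ∧
        ∀ z ∈ Ω₃, ∀ p ∈ P₃, g₁ z p = g₂ z p ∧ r₁ z p = r₂ z p := by
  exact ⟨wdiv_exists m Ω Pdom hΩo hPo hΩ0 hP0 f hf α hα, fun Ω₁ P₁ g₁ r₁ Ω₂ P₂ g₂ r₂ h₁ h₂ =>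
    wdiv_unique m Pdom hP0 f α hα Ω₁ P₁ g₁ r₁ Ω₂ P₂ g₂ r₂ h₁ h₂⟩
end

section
/- Let (z₀,p₀) ∈ ℂ×ℂ, let f : ℂ×ℂ → ℂ be analytic on a neighborhood of (z₀,p₀), and let u be a Weierstrass polynomial of degree m at (z₀,p₀), analytic on a neighborhood of (z₀,p₀). Then there exist a neighborhood U of (z₀,p₀) and functions g, r analytic on U such that for each p, the function z ↦ r(z,p) is a polynomial in z of degree less than m, and f(z,p) = g(z,p)·u(z,p) + r(z,p) for all (z,p) ∈ U. Moreover g and r are unique in the sense that any two such pairs agree on a common neighborhood of (z₀,p₀). -/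
/-- The monic degree-`m` polynomial in `z - z₀` with coefficients `α j p`
(a shifted Weierstrass polynomial when the `α j` vanish at the base parameter). -/
noncomputable def swpoly (z₀ : ℂ) (m : ℕ) (α : ℕ → ℂ → ℂ) (z p : ℂ) : ℂ :=
  (z - z₀) ^ m + ∑ j ∈ Finset.range m, α j p * (z - z₀) ^ j

/-- `(Ω', P', g, r)` is a Weierstrass division of `f` by `u` near `(z₀,p₀)`:
`f = g·u + r` on `Ω' × P'` with `g, r` analytic on `Ω' × P'` and, for each `p ∈ P'`,
`z ↦ r(z,p)` a polynomial in `z` of degree less than `m`. -/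
def IsWDivAt (f u : ℂ → ℂ → ℂ) (m : ℕ) (z₀ p₀ : ℂ) (Ω' P' : Set ℂ)
    (g r : ℂ → ℂ → ℂ) : Prop :=
  IsOpen Ω' ∧ IsOpen P' ∧ z₀ ∈ Ω' ∧ p₀ ∈ P' ∧
  AnalyticOnNhd ℂ (fun q : ℂ × ℂ => g q.1 q.2) (Ω' ×ˢ P') ∧
  AnalyticOnNhd ℂ (fun q : ℂ × ℂ => r q.1 q.2) (Ω' ×ˢ P') ∧
  (∀ p ∈ P', PolyDegLt (fun z => r z p) m) ∧
  ∀ z ∈ Ω', ∀ p ∈ P', f z p = g z p * u z p + r z p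

open Metric Set Filter Topology in
lemma wd_exists_L (c : ℂ) (ρ : ℝ) (hρ : 0 < ρ) :
    ∃ L : C(sphere c ρ, ℂ) →L[ℂ] ℂ, ∀ F : ℂ → ℂ, DiffContOnCl ℂ F (ball c ρ) →
      ∀ z ∈ ball c ρ, ∀ h : C(sphere c ρ, ℂ), (∀ s, h s = ((s : ℂ) - z)⁻¹ * F s) → L h = F z := by
  classical
  have hm : ∀ θ, circleMap c ρ θ ∈ sphere c ρ := fun θ => circleMap_mem_sphere c hρ.le θ
  let γ : C(ℝ, sphere c ρ) := ⟨fun θ => ⟨circleMap c ρ θ, hm θ⟩,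
    (continuous_circleMap c ρ).subtype_mk _⟩
  have hci : ∀ h : C(sphere c ρ, ℂ), IntervalIntegrable
      (fun θ => deriv (circleMap c ρ) θ • h (γ θ)) MeasureTheory.volume 0 (2 * Real.pi) := by
    intro h
    apply Continuous.intervalIntegrable
    simp only [deriv_circleMap]
    have := (h.continuous.comp γ.continuous)
    have h2 := (continuous_circleMap 0 ρ)
    exact (h2.mul continuous_const).smul this
  let L0 : C(sphere c ρ, ℂ) →ₗ[ℂ] ℂ :=
    { toFun := fun h => (2 * Real.pi * Complex.I : ℂ)⁻¹ •
        ∫ θ in (0)..(2 * Real.pi), deriv (circleMap c ρ) θ • h (γ θ)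
      map_add' := by
        intro h k
        rw [← smul_add, ← intervalIntegral.integral_add (hci h) (hci k)]
        simp [mul_add]
      map_smul' := by
        intro a h
        simp only [ContinuousMap.smul_apply, RingHom.id_apply]
        rw [smul_comm a, ← intervalIntegral.integral_smul a]
        congr 1
        apply intervalIntegral.integral_congr
        intro θ _
        exact smul_comm _ _ _ }
  have hL0 : ∀ F : ℂ → ℂ, ∀ h : C(sphere c ρ, ℂ), (∀ s, h s = F s) →
      L0 h = (2 * Real.pi * Complex.I : ℂ)⁻¹ • ∮ z in C(c, ρ), F z := by
    intro F h hh
    change (2 * Real.pi * Complex.I : ℂ)⁻¹ •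
        ∫ θ in (0)..(2 * Real.pi), deriv (circleMap c ρ) θ • h (γ θ) = _
    rw [circleIntegral]
    congr 2
    ext θ
    rw [hh]
    rfl
  refine ⟨L0.mkContinuous ρ ?_, ?_⟩
  · intro h
    let F : ℂ → ℂ := fun z => if hz : z ∈ sphere c ρ then h ⟨z, hz⟩ else 0
    rw [hL0 F h (by intro s; simp only [F]; rw [dif_pos s.2])]
    apply circleIntegral.norm_two_pi_i_inv_smul_integral_le_of_norm_le_const hρ.le
    intro z hz
    simp only [F]
    rw [dif_pos hz]
    exact h.norm_coe_le_norm _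
  · intro F hF z hz h hh
    rw [LinearMap.mkContinuous_apply, hL0 (fun s => (s - z)⁻¹ • F s) h (by simpa using hh)]
    exact hF.two_pi_i_inv_smul_circleIntegral_sub_inv_smul hz

open Metric Set Filter Topology in
lemma wd_exists_Phi (K : Set ℂ) [CompactSpace K] (p₀ : ℂ) (δ : ℝ) (hδ : 0 < δ) (f : ℂ → ℂ → ℂ)
    (hf : AnalyticOnNhd ℂ (fun q : ℂ × ℂ => f q.1 q.2) (K ×ˢ closedBall p₀ δ)) :
    ∃ Φ : ℂ → C(K, ℂ), AnalyticOnNhd ℂ Φ (ball p₀ δ) ∧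
      ∀ p ∈ ball p₀ δ, ∀ s, Φ p s = f s p := by
  classical
  have hc : ∀ p ∈ closedBall p₀ δ, Continuous (fun s : K => f s p) := by
    intro p hp
    exact hf.continuousOn.comp_continuous (f := fun s : K => ((s : ℂ), p)) (by fun_prop)
      (fun s => ⟨s.2, hp⟩)
  let Ψ : ℂ → C(K, ℂ) := fun p => if h : Continuous (fun s : K => f s p) then ⟨_, h⟩ else 0
  have hΨ : ∀ p ∈ closedBall p₀ δ, ∀ s, Ψ p s = f s p := by
    intro p hp s
    simp only [Ψ]
    rw [dif_pos (hc p hp)]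
    rfl
  have hΨc : ContinuousOn Ψ (closedBall p₀ δ) := by
    apply ContinuousMap.continuousOn_of_continuousOn_uncurry
    have : ContinuousOn (fun q : ℂ × K => f q.2 q.1) (closedBall p₀ δ ×ˢ univ) :=
      hf.continuousOn.comp (f := fun q : ℂ × K => ((q.2 : ℂ), q.1)) (by fun_prop)
        (fun q hq => ⟨q.2.2, hq.1⟩)
    exact this.congr (fun q hq => hΨ _ hq.1 _)
  have hci : CircleIntegrable Ψ p₀ δ :=
    (hΨc.mono sphere_subset_closedBall).circleIntegrable hδ.le
  lift δ to NNReal using hδ.le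
  have hps := hasFPowerSeriesOn_cauchy_integral hci (by exact_mod_cast hδ)
  have hpa := hps.analyticOnNhd
  rw [show Metric.eball p₀ (δ : ENNReal) = ball p₀ (δ : ℝ) by simp] at hpa
  refine ⟨_, hpa, ?_⟩
  intro p hp s
  have hd : DiffContOnCl ℂ (fun η => f s η) (ball p₀ δ) := by
    apply DifferentiableOn.diffContOnCl
    rw [closure_ball _ hδ.ne']
    intro η hη
    have h1 : DifferentiableAt ℂ (fun q : ℂ × ℂ => f q.1 q.2) ((s : ℂ), η) :=
      (hf ((s : ℂ), η) ⟨s.2, hη⟩).differentiableAt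
    exact (DifferentiableAt.comp (f := fun η : ℂ => ((s : ℂ), η)) η h1
      (by fun_prop)).differentiableWithinAt
  rw [← hd.two_pi_i_inv_smul_circleIntegral_sub_inv_smul hp]
  change (2 * Real.pi * Complex.I : ℂ)⁻¹ • ((∮ z in C(p₀, δ), (z - p)⁻¹ • Ψ z) s) = _
  congr 1
  have hci2 : CircleIntegrable (fun z => (z - p)⁻¹ • Ψ z) p₀ δ := by
    apply ContinuousOn.circleIntegrable hδ.le
    apply ContinuousOn.fun_smul
    · apply ContinuousOn.inv₀ (by fun_prop)
      intro z hz h0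
      rw [sub_eq_zero] at h0
      subst h0
      simp only [mem_sphere, mem_ball] at hz hp
      linarith
    · exact hΨc.mono sphere_subset_closedBall
  have := ContinuousLinearMap.intervalIntegral_comp_comm
    (ContinuousMap.evalCLM ℂ s : C(K, ℂ) →L[ℂ] ℂ) hci2.out
  rw [circleIntegral]
  refine this.symm.trans ?_
  rw [circleIntegral]
  congr 1
  ext θ
  have h3 := hΨ (circleMap p₀ δ θ) (sphere_subset_closedBall (circleMap_mem_sphere p₀ hδ.le θ)) s
  simp [ContinuousMap.evalCLM, h3]

open Metric Set Filter Topology in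
lemma wd_unique (n : ℕ) : ∀ (Ω : Set ℂ), IsOpen Ω → ∀ (U R : Polynomial ℂ) (G : ℂ → ℂ),
    U.Monic → U.natDegree = n → (∀ a, U.eval a = 0 → a ∈ Ω) → R.degree < (n : WithBot ℕ) →
    ContinuousOn G Ω → (∀ z ∈ Ω, G z * U.eval z = R.eval z) → ∀ z ∈ Ω, G z = 0 := by
  induction n with
  | zero =>
    intro Ω hΩ U R G hU hn _ hR hG h z hz
    have hU1 : U = 1 := Polynomial.eq_one_of_monic_natDegree_zero hU hn
    have hR0 : R = 0 := by
      rw [← Polynomial.degree_eq_bot]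
      have : R.degree < 0 := by simpa using hR
      exact Nat.WithBot.lt_zero_iff.mp this
    have := h z hz
    simpa [hU1, hR0] using this
  | succ n ih =>
    intro Ω hΩ U R G hU hn hroot hR hG h
    obtain ⟨a, ha⟩ := Complex.exists_root (f := U)
      (Polynomial.natDegree_pos_iff_degree_pos.mp (by omega))
    have haΩ := hroot a ha
    have hRa : R.IsRoot a := by
      have := h a haΩ
      rw [show U.eval a = 0 from ha] at this
      simpa using this.symm
    obtain ⟨U', hU'⟩ := Polynomial.dvd_iff_isRoot.mpr ha
    obtain ⟨R', hR'⟩ := Polynomial.dvd_iff_isRoot.mpr hRa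
    have hmon : U'.Monic := (Polynomial.monic_X_sub_C a).of_mul_monic_left (hU' ▸ hU)
    refine ih Ω hΩ U' R' G hmon ?_ ?_ ?_ hG ?_
    · have := (Polynomial.monic_X_sub_C a).natDegree_mul hmon
      rw [← hU', hn, Polynomial.natDegree_X_sub_C] at this
      omega
    · intro b hb
      apply hroot
      rw [hU', Polynomial.eval_mul, hb, mul_zero]
    · by_cases h0 : R' = 0
      · simp [h0]
      · rw [hR', Polynomial.degree_mul, Polynomial.degree_X_sub_C,
          Polynomial.degree_eq_natDegree h0] at hR
        rw [Polynomial.degree_eq_natDegree h0]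
        norm_cast at hR ⊢
        omega
    · have hne : ∀ z ∈ Ω, z ≠ a → G z * U'.eval z = R'.eval z := by
        intro z hz hza
        have := h z hz
        rw [hU', hR'] at this
        simp only [Polynomial.eval_mul, Polynomial.eval_sub, Polynomial.eval_X,
          Polynomial.eval_C] at this
        apply mul_left_cancel₀ (sub_ne_zero.mpr hza)
        rw [← this]; ring
      intro z hz
      by_cases hza : z = a
      · subst hza
        have hGz : ContinuousAt G z := hG.continuousAt (hΩ.mem_nhds hz)
        have h1 : Tendsto (fun w => G w * U'.eval w) (𝓝[≠] z) (𝓝 (G z * U'.eval z)) :=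
          ((hGz.mul U'.continuous.continuousAt).tendsto).mono_left nhdsWithin_le_nhds
        have h2 : Tendsto (fun w => R'.eval w) (𝓝[≠] z) (𝓝 (R'.eval z)) :=
          (R'.continuous.continuousAt.tendsto).mono_left nhdsWithin_le_nhds
        refine tendsto_nhds_unique (h1.congr' ?_) h2
        filter_upwards [self_mem_nhdsWithin, nhdsWithin_le_nhds (hΩ.mem_nhds hz)] with w hw hw2
        exact hne w hw2 hw
      · exact hne z hz hza

open Metric Set Filter Topology in
lemma wd_nonvanish (z₀ p₀ : ℂ) (m : ℕ) (α : ℕ → ℂ → ℂ)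
    (hα : ∀ j < m, ContinuousAt (α j) p₀ ∧ α j p₀ = 0) (ρ : ℝ) (hρ : 0 < ρ) :
    ∀ᶠ p in 𝓝 p₀, ∀ z, ρ ≤ ‖z - z₀‖ → swpoly z₀ m α z p ≠ 0 := by
  have hc : ContinuousAt (fun p => ∑ j ∈ Finset.range m, ‖α j p‖ * ρ ^ j) p₀ := by
    apply tendsto_finsetSum
    intro j hj
    exact ((hα j (Finset.mem_range.mp hj)).1.norm).mul continuousAt_const
  have h0 : (∑ j ∈ Finset.range m, ‖α j p₀‖ * ρ ^ j) < ρ ^ m := by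
    rw [Finset.sum_eq_zero]
    · positivity
    · intro j hj
      simp [(hα j (Finset.mem_range.mp hj)).2]
  filter_upwards [hc.eventually (gt_mem_nhds h0)] with p hp z hz hzero
  have hw : 0 < ‖z - z₀‖ := hρ.trans_le hz
  rw [swpoly, add_eq_zero_iff_eq_neg] at hzero
  have h1 : ‖z - z₀‖ ^ m ≤ ∑ j ∈ Finset.range m, ‖α j p‖ * ‖z - z₀‖ ^ j := by
    rw [← norm_pow, hzero, norm_neg]
    refine (norm_sum_le _ _).trans (le_of_eq ?_)
    simp
  have h2 : ‖z - z₀‖ ^ m * ρ ^ m ≤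
      ‖z - z₀‖ ^ m * ∑ j ∈ Finset.range m, ‖α j p‖ * ρ ^ j := by
    refine (mul_le_mul_of_nonneg_right h1 (by positivity)).trans ?_
    rw [Finset.sum_mul, Finset.mul_sum]
    apply Finset.sum_le_sum
    intro j hj
    have hj := Finset.mem_range.mp hj
    obtain ⟨k, rfl⟩ := Nat.exists_eq_add_of_lt hj
    have : ρ ^ (k + 1) ≤ ‖z - z₀‖ ^ (k + 1) := pow_le_pow_left₀ hρ.le hz _
    calc ‖α j p‖ * ‖z - z₀‖ ^ j * ρ ^ (j + k + 1)
        = (‖α j p‖ * ‖z - z₀‖ ^ j * ρ ^ j) * ρ ^ (k + 1) := by ring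
      _ ≤ (‖α j p‖ * ‖z - z₀‖ ^ j * ρ ^ j) * ‖z - z₀‖ ^ (k + 1) := by gcongr
      _ = _ := by ring
  have h3 := le_of_mul_le_mul_left h2 (by positivity)
  linarith

open Metric Set Filter Topology in
lemma wd_exists
    (m : ℕ) (z₀ p₀ : ℂ) (ρ δ : ℝ) (hρ : 0 < ρ) (hδ : 0 < δ)
    (f : ℂ → ℂ → ℂ)
    (hf : AnalyticOnNhd ℂ (fun q : ℂ × ℂ => f q.1 q.2) (closedBall z₀ ρ ×ˢ closedBall p₀ δ))
    (α : ℕ → ℂ → ℂ)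
    (hα : ∀ j < m, AnalyticOnNhd ℂ (α j) (ball p₀ δ))
    (hnv : ∀ p ∈ ball p₀ δ, ∀ z, ρ ≤ ‖z - z₀‖ → swpoly z₀ m α z p ≠ 0) :
    ∃ g r, IsWDivAt f (swpoly z₀ m α) m z₀ p₀ (ball z₀ ρ) (ball p₀ δ) g r := by
  obtain ⟨L, hL⟩ := wd_exists_L z₀ ρ hρ
  obtain ⟨Φ, hΦa, hΦ⟩ := wd_exists_Phi (sphere z₀ ρ) p₀ δ hδ f
    (hf.mono (prod_mono sphere_subset_closedBall subset_rfl))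
  let V : C(sphere z₀ ρ, ℂ) := ⟨fun s => (s : ℂ) - z₀, by fun_prop⟩
  let D : ℂ → C(sphere z₀ ρ, ℂ) := fun z => V - (z - z₀) • 1
  let U : ℂ → C(sphere z₀ ρ, ℂ) := fun p => V ^ m + ∑ j ∈ Finset.range m, α j p • V ^ j
  have hDu : ∀ z ∈ ball z₀ ρ, IsUnit (D z) := by
    intro z hz
    rw [ContinuousMap.isUnit_iff_forall_ne_zero]
    intro s hs
    have h1 : (s : ℂ) = z := by
      have : ((s : ℂ) - z₀) - (z - z₀) = 0 := by simpa [D, V] using hs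
      linear_combination this
    have h2 := s.2
    rw [h1, mem_sphere] at h2
    rw [mem_ball] at hz
    linarith
  have hUs : ∀ p s, U p s = swpoly z₀ m α s p := by
    intro p s
    simp [U, V, swpoly]
  have hUu : ∀ p ∈ ball p₀ δ, IsUnit (U p) := by
    intro p hp
    rw [ContinuousMap.isUnit_iff_forall_ne_zero]
    intro s
    rw [hUs]
    apply hnv p hp
    have := s.2
    rw [mem_sphere, dist_eq_norm] at this
    exact this.ge
  have hDa : ∀ z, AnalyticAt ℂ D z := by
    intro z
    exact analyticAt_const.sub ((analyticAt_id.sub analyticAt_const).smul analyticAt_const)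
  have hUa : ∀ p ∈ ball p₀ δ, AnalyticAt ℂ U p := by
    intro p hp
    apply analyticAt_const.add
    apply Finset.analyticAt_fun_sum
    intro j hj
    exact (hα j (Finset.mem_range.mp hj) p hp).smul analyticAt_const
  have hWa : ∀ z ∈ ball z₀ ρ, AnalyticAt ℂ (fun z => Ring.inverse (D z)) z := by
    intro z hz
    exact (analyticAt_inverse (𝕜 := ℂ) (hDu z hz).unit).comp_of_eq (hDa z) rfl
  let H : ℂ → C(sphere z₀ ρ, ℂ) := fun p => Φ p * Ring.inverse (U p)
  have hHa : ∀ p ∈ ball p₀ δ, AnalyticAt ℂ H p := by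
    intro p hp
    exact (hΦa p hp).mul
      ((analyticAt_inverse (𝕜 := ℂ) (hUu p hp).unit).comp_of_eq (hUa p hp) rfl)
  let Q : ℕ → ℂ → ℂ → ℂ := fun j z p =>
    ∑ i ∈ Finset.range j, L (H p * V ^ i) * (z - z₀) ^ (j - 1 - i)
  have hQ : ∀ j z p, Q j z p * 1 = L (H p * (∑ i ∈ Finset.range j,
      V ^ i * ((z - z₀) • (1 : C(sphere z₀ ρ, ℂ))) ^ (j - 1 - i))) := by
    intro j z p
    rw [Finset.mul_sum, map_sum, mul_one]
    apply Finset.sum_congr rfl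
    intro i _
    rw [smul_pow, one_pow, mul_smul_comm, mul_smul_comm, map_smul, mul_one, smul_eq_mul, mul_comm]
  have hQa : ∀ j, ∀ q : ℂ × ℂ, q.2 ∈ ball p₀ δ →
      AnalyticAt ℂ (fun q : ℂ × ℂ => Q j q.1 q.2) q := by
    intro j q hq
    apply Finset.analyticAt_fun_sum
    intro i _
    apply AnalyticAt.mul
    · have h1 : AnalyticAt ℂ (fun p => L (H p * V ^ i)) q.2 :=
        (L.analyticAt _).comp ((hHa _ hq).mul analyticAt_const)
      exact h1.comp_of_eq analyticAt_snd rfl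
    · exact (analyticAt_fst.sub analyticAt_const).pow _
  have hUQ : ∀ z p, z ∈ ball z₀ ρ → p ∈ ball p₀ δ →
      f z p = L (H p * Ring.inverse (D z)) * swpoly z₀ m α z p +
        (Q m z p + ∑ j ∈ Finset.range m, α j p * Q j z p) := by
    intro z p hz hp
    have hd : DiffContOnCl ℂ (fun ζ => f ζ p) (ball z₀ ρ) := by
      apply DifferentiableOn.diffContOnCl
      rw [closure_ball _ hρ.ne']
      intro ζ hζ
      have h1 : DifferentiableAt ℂ (fun q : ℂ × ℂ => f q.1 q.2) (ζ, p) :=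
        (hf (ζ, p) ⟨hζ, ball_subset_closedBall hp⟩).differentiableAt
      exact (DifferentiableAt.comp (f := fun ζ : ℂ => (ζ, p)) ζ h1
        (by fun_prop)).differentiableWithinAt
    have hDW : D z * Ring.inverse (D z) = 1 := Ring.mul_inverse_cancel _ (hDu z hz)
    have hUW : U p * Ring.inverse (U p) = 1 := Ring.mul_inverse_cancel _ (hUu p hp)
    have hcauchy : L (Φ p * Ring.inverse (D z)) = f z p := by
      apply hL _ hd z hz
      intro s
      have h1 : D z s * Ring.inverse (D z) s = 1 := by
        rw [← ContinuousMap.mul_apply, hDW]; rfl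
      have h2 : D z s = (s : ℂ) - z := by simp [D, V]
      rw [h2] at h1
      rw [ContinuousMap.mul_apply, hΦ p hp, eq_inv_of_mul_eq_one_right h1, mul_comm]
    have hgeom : ∀ j, V ^ j = (z - z₀) ^ j • (1 : C(sphere z₀ ρ, ℂ)) +
        D z * (∑ i ∈ Finset.range j,
          V ^ i * ((z - z₀) • (1 : C(sphere z₀ ρ, ℂ))) ^ (j - 1 - i)) := by
      intro j
      have := (Commute.all V ((z - z₀) • (1 : C(sphere z₀ ρ, ℂ)))).mul_geom_sum₂ j
      rw [smul_pow, one_pow] at this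
      simp only [D]
      rw [this]
      abel
    have hUD : U p = swpoly z₀ m α z p • (1 : C(sphere z₀ ρ, ℂ)) + D z *
        ((∑ i ∈ Finset.range m,
            V ^ i * ((z - z₀) • (1 : C(sphere z₀ ρ, ℂ))) ^ (m - 1 - i)) +
          ∑ j ∈ Finset.range m, α j p • (∑ i ∈ Finset.range j,
            V ^ i * ((z - z₀) • (1 : C(sphere z₀ ρ, ℂ))) ^ (j - 1 - i))) := by
      have hs : ∑ j ∈ Finset.range m, α j p • V ^ j =
          (∑ j ∈ Finset.range m, α j p * (z - z₀) ^ j) • (1 : C(sphere z₀ ρ, ℂ)) +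
          D z * ∑ j ∈ Finset.range m, α j p • (∑ i ∈ Finset.range j,
            V ^ i * ((z - z₀) • (1 : C(sphere z₀ ρ, ℂ))) ^ (j - 1 - i)) := by
        rw [Finset.sum_smul, Finset.mul_sum, ← Finset.sum_add_distrib]
        apply Finset.sum_congr rfl
        intro j _
        rw [hgeom j, smul_add, smul_smul, mul_smul_comm]
      simp only [U]
      rw [hs, hgeom m, ← hgeom m, swpoly, add_smul, mul_add]
      nth_rewrite 1 [hgeom m]
      abel
    have hR : L (H p * ((∑ i ∈ Finset.range m,
            V ^ i * ((z - z₀) • (1 : C(sphere z₀ ρ, ℂ))) ^ (m - 1 - i)) +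
          ∑ j ∈ Finset.range m, α j p • (∑ i ∈ Finset.range j,
            V ^ i * ((z - z₀) • (1 : C(sphere z₀ ρ, ℂ))) ^ (j - 1 - i)))) =
        Q m z p + ∑ j ∈ Finset.range m, α j p * Q j z p := by
      rw [mul_add, map_add, ← hQ, mul_one, Finset.mul_sum, map_sum]
      congr 1
      apply Finset.sum_congr rfl
      intro j _
      rw [mul_smul_comm, map_smul, ← hQ, mul_one, smul_eq_mul]
    rw [← hR, ← hcauchy, mul_comm (L _) (swpoly _ _ _ _ _), ← smul_eq_mul (swpoly _ _ _ _ _) (L _), ← map_smul, ← map_add]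
    congr 1
    generalize ((∑ i ∈ Finset.range m,
            V ^ i * ((z - z₀) • (1 : C(sphere z₀ ρ, ℂ))) ^ (m - 1 - i)) +
          ∑ j ∈ Finset.range m, α j p • (∑ i ∈ Finset.range j,
            V ^ i * ((z - z₀) • (1 : C(sphere z₀ ρ, ℂ))) ^ (j - 1 - i))) = T at hUD ⊢
    have e1 : swpoly z₀ m α z p • (H p * Ring.inverse (D z)) =
        H p * Ring.inverse (D z) * (swpoly z₀ m α z p • (1 : C(sphere z₀ ρ, ℂ))) := by
      rw [mul_smul_comm, mul_one]
    rw [e1]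
    have e2 : Φ p = H p * U p := by
      simp only [H]
      rw [mul_assoc, mul_comm (Ring.inverse _), hUW, mul_one]
    rw [e2, hUD]
    linear_combination (H p * T) * hDW
  refine ⟨fun z p => L (H p * Ring.inverse (D z)),
    fun z p => Q m z p + ∑ j ∈ Finset.range m, α j p * Q j z p,
    isOpen_ball, isOpen_ball, mem_ball_self hρ, mem_ball_self hδ, ?_, ?_, ?_, ?_⟩
  · rintro q ⟨hq1, hq2⟩
    have h1 : AnalyticAt ℂ (fun q : ℂ × ℂ => H q.2) q := (hHa _ hq2).comp_of_eq analyticAt_snd rfl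
    have h2 : AnalyticAt ℂ (fun q : ℂ × ℂ => Ring.inverse (D q.1)) q :=
      (hWa _ hq1).comp_of_eq analyticAt_fst rfl
    exact (L.analyticAt _).comp (h1.mul h2)
  · rintro q ⟨hq1, hq2⟩
    apply (hQa m q hq2).add
    apply Finset.analyticAt_fun_sum
    intro j hj
    exact ((hα j (Finset.mem_range.mp hj) _ hq2).comp_of_eq analyticAt_snd rfl).mul (hQa j q hq2)
  · intro p hp
    let S : ℕ → Polynomial ℂ := fun j => ∑ i ∈ Finset.range j,
      Polynomial.C (L (H p * V ^ i)) * (Polynomial.X - Polynomial.C z₀) ^ (j - 1 - i)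
    have hS : ∀ j z, Q j z p = (S j).eval z := by
      intro j z
      simp [Q, S, Polynomial.eval_finsetSum]
    have hSd : ∀ j ≤ m, S j ∈ Polynomial.degreeLT ℂ m := by
      intro j hj
      apply Submodule.sum_mem
      intro i hi
      have hi := Finset.mem_range.mp hi
      rw [← Polynomial.smul_eq_C_mul]
      apply Submodule.smul_mem
      rw [Polynomial.mem_degreeLT, Polynomial.degree_pow, Polynomial.degree_X_sub_C]
      simp only [nsmul_eq_mul, mul_one]
      norm_cast
      omega
    refine ⟨S m + ∑ j ∈ Finset.range m, α j p • S j, ?_, ?_⟩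
    · rw [← Polynomial.mem_degreeLT]
      apply Submodule.add_mem _ (hSd m le_rfl)
      apply Submodule.sum_mem
      intro j hj
      exact Submodule.smul_mem _ _ (hSd j (Finset.mem_range.mp hj).le)
    · intro z
      simp [hS, Polynomial.eval_finsetSum]
  · intro z hz p hp
    exact hUQ z p hz hp


/-- **Weierstrass division theorem at an arbitrary base point** (Corollary B.8): division
of an analytic `f` by a Weierstrass polynomial `u` of degree `m` at `(z₀,p₀)`, with the
quotient and remainder unique in the sense that any two such pairs agree on a common
neighborhood of `(z₀,p₀)`. -/
theorem weierstrass_division_at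
    (m : ℕ) (z₀ p₀ : ℂ) (Ω Pdom : Set ℂ) (hΩo : IsOpen Ω) (hPo : IsOpen Pdom)
    (hΩ0 : z₀ ∈ Ω) (hP0 : p₀ ∈ Pdom)
    (f : ℂ → ℂ → ℂ)
    (hf : AnalyticOnNhd ℂ (fun q : ℂ × ℂ => f q.1 q.2) (Ω ×ˢ Pdom))
    (α : ℕ → ℂ → ℂ)
    (hα : ∀ j < m, AnalyticOnNhd ℂ (α j) Pdom ∧ α j p₀ = 0) :
    (∃ Ω' P' g r, Ω' ⊆ Ω ∧ P' ⊆ Pdom ∧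
      IsWDivAt f (swpoly z₀ m α) m z₀ p₀ Ω' P' g r) ∧
    ∀ Ω₁ P₁ g₁ r₁ Ω₂ P₂ g₂ r₂,
      IsWDivAt f (swpoly z₀ m α) m z₀ p₀ Ω₁ P₁ g₁ r₁ →
      IsWDivAt f (swpoly z₀ m α) m z₀ p₀ Ω₂ P₂ g₂ r₂ →
      ∃ Ω₃ P₃ : Set ℂ, IsOpen Ω₃ ∧ IsOpen P₃ ∧ z₀ ∈ Ω₃ ∧ p₀ ∈ P₃ ∧
        ∀ z ∈ Ω₃, ∀ p ∈ P₃, g₁ z p = g₂ z p ∧ r₁ z p = r₂ z p := by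
  have hev : ∀ ρ > 0, ∀ᶠ p in nhds p₀, ∀ z, ρ ≤ ‖z - z₀‖ → swpoly z₀ m α z p ≠ 0 :=
    fun ρ hρ => wd_nonvanish z₀ p₀ m α
      (fun j hj => ⟨((hα j hj).1 p₀ hP0).continuousAt, (hα j hj).2⟩) ρ hρ
  constructor
  · obtain ⟨ρ, hρ, hρΩ⟩ := Metric.nhds_basis_closedBall.mem_iff.mp (hΩo.mem_nhds hΩ0)
    obtain ⟨δ, hδ, hδP⟩ := Metric.nhds_basis_closedBall.mem_iff.mp
      (Filter.inter_mem (hPo.mem_nhds hP0) (hev ρ hρ))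
    have hδ1 : Metric.closedBall p₀ δ ⊆ Pdom := fun p hp => (hδP hp).1
    obtain ⟨g, r, h⟩ := wd_exists m z₀ p₀ ρ δ hρ hδ f (hf.mono (Set.prod_mono hρΩ hδ1)) α
      (fun j hj => (hα j hj).1.mono (Metric.ball_subset_closedBall.trans hδ1))
      (fun p hp => (hδP (Metric.ball_subset_closedBall hp)).2)
    exact ⟨_, _, g, r, Metric.ball_subset_closedBall.trans hρΩ,
      Metric.ball_subset_closedBall.trans hδ1, h⟩
  · rintro Ω₁ P₁ g₁ r₁ Ω₂ P₂ g₂ r₂ ⟨hΩ₁, hP₁, hz₁, hp₁, hg₁, -, hd₁, he₁⟩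
      ⟨hΩ₂, hP₂, hz₂, hp₂, hg₂, -, hd₂, he₂⟩
    have hΩ := hΩ₁.inter hΩ₂
    obtain ⟨ρ, hρ, hρΩ⟩ := Metric.nhds_basis_ball.mem_iff.mp (hΩ.mem_nhds ⟨hz₁, hz₂⟩)
    obtain ⟨δ, hδ, hδP⟩ := Metric.nhds_basis_ball.mem_iff.mp
      (Filter.inter_mem ((hP₁.inter hP₂).mem_nhds ⟨hp₁, hp₂⟩) (hev ρ hρ))
    refine ⟨Ω₁ ∩ Ω₂, Metric.ball p₀ δ, hΩ, Metric.isOpen_ball, ⟨hz₁, hz₂⟩,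
      Metric.mem_ball_self hδ, ?_⟩
    intro z hz p hp
    obtain ⟨⟨hpP₁, hpP₂⟩, hnv⟩ := hδP hp
    obtain ⟨q₁, hq₁, hr₁⟩ := hd₁ p hpP₁
    obtain ⟨q₂, hq₂, hr₂⟩ := hd₂ p hpP₂
    let T : Polynomial ℂ := Polynomial.X ^ m +
      ∑ j ∈ Finset.range m, Polynomial.C (α j p) * Polynomial.X ^ j
    have hTd : (∑ j ∈ Finset.range m, Polynomial.C (α j p) * Polynomial.X ^ j).degree <
        (m : WithBot ℕ) := by
      rw [← Polynomial.mem_degreeLT]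
      apply Submodule.sum_mem
      intro j hj
      rw [Polynomial.mem_degreeLT]
      refine (Polynomial.degree_C_mul_X_pow_le _ _).trans_lt ?_
      exact_mod_cast Finset.mem_range.mp hj
    have hTm : T.Monic := Polynomial.monic_X_pow_add hTd
    have hTn : T.natDegree = m := by
      apply Polynomial.natDegree_eq_of_degree_eq_some
      rw [Polynomial.degree_add_eq_left_of_degree_lt] <;> rw [Polynomial.degree_X_pow]
      exact hTd
    let U : Polynomial ℂ := T.comp (Polynomial.X - Polynomial.C z₀)
    have hUe : ∀ w, U.eval w = swpoly z₀ m α w p := by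
      intro w
      simp [U, T, swpoly, Polynomial.eval_finsetSum]
    have hslice : ∀ (g : ℂ → ℂ → ℂ) (A B : Set ℂ), p ∈ B →
        AnalyticOnNhd ℂ (fun q : ℂ × ℂ => g q.1 q.2) (A ×ˢ B) →
        ContinuousOn (fun w => g w p) A := by
      intro g A B hB hg
      exact hg.continuousOn.comp (f := fun w : ℂ => (w, p)) (by fun_prop) (fun w hw => ⟨hw, hB⟩)
    have hG : ∀ w ∈ Ω₁ ∩ Ω₂, g₁ w p - g₂ w p = 0 := by
      apply wd_unique m (Ω₁ ∩ Ω₂) hΩ U (q₂ - q₁) (fun w => g₁ w p - g₂ w p)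
      · exact hTm.comp_X_sub_C z₀
      · rw [Polynomial.natDegree_comp, hTn, Polynomial.natDegree_X_sub_C, mul_one]
      · intro a ha
        apply hρΩ
        by_contra hcon
        rw [hUe] at ha
        rw [Metric.mem_ball, dist_eq_norm, not_lt] at hcon
        exact hnv a hcon ha
      · exact (Polynomial.degree_sub_le _ _).trans_lt (max_lt hq₂ hq₁)
      · exact ((hslice g₁ _ _ hpP₁ hg₁).mono Set.inter_subset_left).sub
          ((hslice g₂ _ _ hpP₂ hg₂).mono Set.inter_subset_right)
      · intro w hw
        have h1 := he₁ w hw.1 p hpP₁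
        have h2 := he₂ w hw.2 p hpP₂
        have h3 := hr₁ w
        have h4 := hr₂ w
        simp only at h3 h4
        rw [hUe, Polynomial.eval_sub, ← h3, ← h4]
        linear_combination h2 - h1
    have hg := sub_eq_zero.mp (hG z hz)
    refine ⟨hg, ?_⟩
    have h1 := he₁ z hz.1 p hpP₁
    have h2 := he₂ z hz.2 p hpP₂
    rw [h1, hg] at h2
    exact add_left_cancel h2
end

section
/- Let Ω, Π ⊆ ℂ be domains, let f : ℂ×ℂ → ℂ be analytic on Ω×Π, and let u(z,p) = z^m + α_{m−1}(p) z^{m−1} + ⋯ + α_1(p) z + α_0(p) where each α_j : ℂ → ℂ is analytic on Π. Assume that for every p ∈ Π, every root of the polynomial u(·,p) lies in Ω. Then there exist unique functions g, r analytic on Ω×Π such that for each p ∈ Π the function z ↦ r(z,p) is a polynomial in z of degree less than m, and f(z,p) = g(z,p)·u(z,p) + r(z,p) for all (z,p) ∈ Ω×Π. -/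
open Metric Set Filter Topology

lemma gw_param {S : Set ℂ} [CompactSpace S] {V : Set ℂ} (hV : IsOpen V)
    (H : ℂ → ℂ → ℂ) (hc : ContinuousOn (fun q : ℂ × ℂ => H q.1 q.2) (S ×ˢ V))
    (hd : ∀ ζ ∈ S, DifferentiableOn ℂ (H ζ) V) :
    ∃ A : ℂ → C(S, ℂ), (∀ p ∈ V, ∀ ζ : S, A p ζ = H ζ p) ∧
      AnalyticOnNhd ℂ A V := by
  classical
  have hcont : ∀ p ∈ V, Continuous (fun ζ : S => H ζ p) := by
    intro p hp
    exact hc.comp_continuous (f := fun ζ : S => ((ζ : ℂ), p)) (by fun_prop) (fun ζ => ⟨ζ.2, hp⟩)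
  let A : ℂ → C(S, ℂ) := fun p =>
    if h : Continuous (fun ζ : S => H ζ p) then ⟨_, h⟩ else 0
  have hA : ∀ p ∈ V, ∀ ζ : S, A p ζ = H ζ p := by
    intro p hp ζ
    simp [A, hcont p hp]
  refine ⟨A, hA, ?_⟩
  have hAc : ContinuousOn A V := by
    rw [continuousOn_iff_continuous_domRestrict]
    apply ContinuousMap.continuous_of_continuous_uncurry
    have : (Function.uncurry fun (x : V) (y : S) => (V.domRestrict A x) y)
        = fun q : V × S => (fun q : ℂ × ℂ => H q.1 q.2) ((q.2 : ℂ), (q.1 : ℂ)) := by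
      ext ⟨x, y⟩
      exact hA x x.2 y
    rw [this]
    exact hc.comp_continuous (by fun_prop) (fun q => ⟨q.2.2, q.1.2⟩)
  intro p hp
  obtain ⟨r, hr, hrV⟩ := nhds_basis_closedBall.mem_iff.mp (hV.mem_nhds hp)
  lift r to NNReal using hr.le
  have hAs : ContinuousOn A (sphere p r) := hAc.mono (sphere_subset_closedBall.trans hrV)
  have hci : CircleIntegrable A p r := hAs.circleIntegrable r.2
  have hps := (hasFPowerSeriesOn_cauchy_integral hci (by exact_mod_cast hr)).analyticAt
  refine hps.congr ?_
  filter_upwards [ball_mem_nhds p hr] with w hw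
  ext ζ
  have hdc : DiffContOnCl ℂ (H ζ) (ball p r) := by
    apply DifferentiableOn.diffContOnCl
    apply (hd ζ ζ.2).mono
    exact closure_ball_subset_closedBall.trans hrV
  have := hdc.two_pi_i_inv_smul_circleIntegral_sub_inv_smul hw
  rw [hA w (hrV (ball_subset_closedBall hw)), ← this]
  simp only [ContinuousMap.smul_apply]
  congr 1
  have hint : IntervalIntegrable (fun θ : ℝ => deriv (circleMap p r) θ •
      ((circleMap p r θ - w)⁻¹ • A (circleMap p r θ))) MeasureTheory.volume 0 (2 * Real.pi) := by
    have h2 : CircleIntegrable (fun z => (z - w)⁻¹ • A z) p r := by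
      apply ContinuousOn.circleIntegrable r.2
      refine ContinuousOn.fun_smul ?_ hAs
      apply ContinuousOn.inv₀ (by fun_prop)
      intro z hz h0
      rw [sub_eq_zero] at h0
      subst h0
      exact (sphere_disjoint_ball.le_bot ⟨hz, hw⟩)
    exact h2.out
  have := ContinuousLinearMap.intervalIntegral_comp_comm (𝕜 := ℂ) (ContinuousMap.evalCLM ℂ ζ) hint
  rw [circleIntegral, circleIntegral]
  refine Eq.trans this.symm ?_
  refine intervalIntegral.integral_congr ?_
  intro θ _
  simp only [ContinuousMap.evalCLM_apply, ContinuousMap.smul_apply]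
  rw [hA]
  exact hrV (sphere_subset_closedBall (circleMap_mem_sphere p r.2 θ))

lemma gw_int {T : Set ℂ} [CompactSpace T] (c : ℂ) {ε : ℝ} (hε : 0 ≤ ε)
    (h : sphere c ε ⊆ T) :
    ∃ L : C(T, ℂ) →L[ℂ] ℂ, ∀ (k : C(T, ℂ)) (φ : ℂ → ℂ), (∀ ζ : T, k ζ = φ ζ) →
      L k = ∮ ζ in C(c, ε), φ ζ := by
  let e : ℝ → T := fun θ => ⟨circleMap c ε θ, h (circleMap_mem_sphere c hε θ)⟩
  have he : Continuous e := by
    apply Continuous.subtype_mk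
    fun_prop
  have hdc : Continuous (deriv (circleMap c ε)) := by
    have : deriv (circleMap c ε) = fun θ => circleMap 0 ε θ * Complex.I := by
      ext θ; simp
    rw [this]; fun_prop
  have hi : ∀ k : C(T, ℂ), IntervalIntegrable (fun θ => deriv (circleMap c ε) θ • k (e θ))
      MeasureTheory.volume 0 (2 * Real.pi) := by
    intro k
    apply Continuous.intervalIntegrable
    fun_prop
  let L0 : C(T, ℂ) →ₗ[ℂ] ℂ :=
    { toFun := fun k => ∫ θ in (0:ℝ)..(2 * Real.pi), deriv (circleMap c ε) θ • k (e θ)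
      map_add' := by
        intro k l
        rw [← intervalIntegral.integral_add (hi k) (hi l)]
        simp [mul_add]
      map_smul' := by
        intro a k
        simp only [RingHom.id_apply]
        rw [← intervalIntegral.integral_smul]
        refine intervalIntegral.integral_congr fun θ _ => ?_
        simp; ring }
  refine ⟨L0.mkContinuous (ε * |2 * Real.pi - 0|) ?_, ?_⟩
  · intro k
    have := intervalIntegral.norm_integral_le_of_norm_le_const (a := 0) (b := 2 * Real.pi)
      (C := ε * ‖k‖) (f := fun θ => deriv (circleMap c ε) θ • k (e θ)) (by
        intro θ _
        rw [norm_smul]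
        gcongr
        · simp [abs_of_nonneg hε]
        · exact k.norm_coe_le_norm _)
    calc ‖L0 k‖ ≤ _ := this
      _ = _ := by ring
  · intro k φ hk
    change ∫ θ in (0:ℝ)..(2 * Real.pi), deriv (circleMap c ε) θ • k (e θ) = _
    rw [circleIntegral]
    simp [hk, e]

/-- uniqueness -/
lemma gw_unique {D : Set ℂ} (hD : IsOpen D) (s : Multiset ℂ) : (∀ a ∈ s, a ∈ D) →
    ∀ (h : ℂ → ℂ), ContinuousOn h D → ∀ q : Polynomial ℂ,
    q.degree < (Multiset.card s : WithBot ℕ) →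
    (∀ z ∈ D, q.eval z = h z * ((s.map fun a => Polynomial.X - Polynomial.C a).prod).eval z) →
    q = 0 ∧ ∀ z ∈ D, h z = 0 := by
  induction s using Multiset.induction_on with
  | empty =>
    intro _ h _ q hq hz
    have : q = 0 := by
      rw [← Polynomial.degree_eq_bot]
      simpa [Nat.WithBot.lt_zero_iff] using hq
    subst this
    refine ⟨rfl, fun z hzD => ?_⟩
    have := hz z hzD
    simpa using this.symm
  | cons a s ih =>
    intro hs h hc q hq hz
    have ha : a ∈ D := hs a (by simp)
    have hroot : q.IsRoot a := by
      have := hz a ha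
      simpa using this
    obtain ⟨q', rfl⟩ := Polynomial.dvd_iff_isRoot.mpr hroot
    have hq' : q'.degree < (Multiset.card s : WithBot ℕ) := by
      by_cases h0 : q' = 0
      · subst h0; simp
      · rw [Polynomial.degree_mul, Polynomial.degree_X_sub_C, Polynomial.degree_eq_natDegree h0] at hq
        rw [Polynomial.degree_eq_natDegree h0]
        simp only [Multiset.card_cons] at hq
        norm_cast at hq ⊢
        omega
    set u' := (s.map fun a => Polynomial.X - Polynomial.C a).prod with hu'
    have key : ∀ z ∈ D, z ≠ a → q'.eval z = h z * u'.eval z := by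
      intro z hzD hza
      have := hz z hzD
      simp only [Multiset.map_cons, Multiset.prod_cons, Polynomial.eval_mul, Polynomial.eval_sub,
        Polynomial.eval_X, Polynomial.eval_C, ← hu'] at this
      have hne : z - a ≠ 0 := sub_ne_zero.mpr hza
      apply mul_left_cancel₀ hne
      rw [this]; ring
    have keya : q'.eval a = h a * u'.eval a := by
      have hca : ContinuousAt h a := hc.continuousAt (hD.mem_nhds ha)
      have t1 : Tendsto (fun z => q'.eval z) (𝓝[≠] a) (𝓝 (q'.eval a)) :=
        (q'.continuous.tendsto a).mono_left nhdsWithin_le_nhds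
      have t2 : Tendsto (fun z => h z * u'.eval z) (𝓝[≠] a) (𝓝 (h a * u'.eval a)) :=
        (hca.tendsto.mul (u'.continuous.tendsto a)).mono_left nhdsWithin_le_nhds
      refine tendsto_nhds_unique_of_eventuallyEq t1 t2 ?_
      filter_upwards [self_mem_nhdsWithin, nhdsWithin_le_nhds (hD.mem_nhds ha)] with z h1 h2
      exact key z h2 h1
    obtain ⟨h1, h2⟩ := ih (fun b hb => hs b (by simp [hb])) h hc q' hq' (by
      intro z hzD
      by_cases hza : z = a
      · rw [hza]; exact keya
      · exact key z hzD hza)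
    exact ⟨by rw [h1, mul_zero], h2⟩

lemma gw_eval (m : ℕ) (α : ℕ → ℂ → ℂ) (p : ℂ) : ∃ P : Polynomial ℂ, P.Monic ∧
    Multiset.card P.roots = m ∧ (P.roots.map fun a => Polynomial.X - Polynomial.C a).prod = P ∧
    ∀ z, P.eval z = wpoly m α z p := by
  let Q : Polynomial ℂ := ∑ j ∈ Finset.range m, Polynomial.C (α j p) * Polynomial.X ^ j
  have hQ : Q.degree < (m : WithBot ℕ) := by
    rw [← Polynomial.mem_degreeLT]
    refine Submodule.sum_mem _ fun j hj => ?_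
    rw [Polynomial.mem_degreeLT]
    refine (Polynomial.degree_C_mul_X_pow_le _ _).trans_lt ?_
    exact_mod_cast Finset.mem_range.mp hj
  have hm : (Polynomial.X ^ m + Q).Monic := Polynomial.monic_X_pow_add hQ
  have hs := IsAlgClosed.splits (Polynomial.X ^ m + Q)
  have hdeg : (Polynomial.X ^ m + Q).natDegree = m := by
    apply Polynomial.natDegree_eq_of_degree_eq_some
    rw [Polynomial.degree_add_eq_left_of_degree_lt] <;> simp [hQ]
  refine ⟨Polynomial.X ^ m + Q, hm, ?_, ?_, ?_⟩
  · rw [← hs.natDegree_eq_card_roots, hdeg]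
  · exact (hs.eq_prod_roots_of_monic hm).symm
  · intro z
    simp [Q, wpoly, Polynomial.eval_finsetSum]

lemma gw_wpoly_analytic (m : ℕ) (α : ℕ → ℂ → ℂ) {P : Set ℂ}
    (hα : ∀ j < m, AnalyticOnNhd ℂ (α j) P) :
    AnalyticOnNhd ℂ (fun q : ℂ × ℂ => wpoly m α q.1 q.2) (univ ×ˢ P) := by
  intro q hq
  unfold wpoly
  refine (analyticAt_fst.fun_pow m).fun_add ?_
  refine Finset.analyticAt_fun_sum _ fun j hj => ?_
  exact ((hα j (Finset.mem_range.mp hj) q.2 hq.2).fun_comp analyticAt_snd).fun_mul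
    (analyticAt_fst.fun_pow j)

lemma gw_nonvanish (m : ℕ) (α : ℕ → ℂ → ℂ) {P : Set ℂ} (hP : IsOpen P)
    (hα : ∀ j < m, AnalyticOnNhd ℂ (α j) P) {D : Set ℂ} (hD : IsOpen D) {p0 : ℂ} (hp0 : p0 ∈ P)
    (h0 : ∀ z, wpoly m α z p0 = 0 → z ∈ D) :
    ∀ᶠ p in 𝓝 p0, ∀ z, z ∉ D → wpoly m α z p ≠ 0 := by
  have hb : ∀ᶠ p in 𝓝 p0, ∀ j ∈ Finset.range m, ‖α j p‖ < ‖α j p0‖ + 1 := by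
    rw [Filter.eventually_all_finset]
    intro j hj
    have := (hα j (Finset.mem_range.mp hj) p0 hp0).continuousAt.norm
    exact this.eventually_lt_const (by linarith)
  set B : ℝ := ∑ j ∈ Finset.range m, (‖α j p0‖ + 1) with hB
  have hK : IsCompact (closedBall (0 : ℂ) (B + 1) \ D) := (isCompact_closedBall _ _).diff hD
  have h2 : ∀ᶠ p in 𝓝 p0, ∀ z ∈ closedBall (0 : ℂ) (B + 1) \ D, wpoly m α z p ≠ 0 := by
    apply hK.eventually_forall_of_forall_eventually
    intro z hz
    have hc : ContinuousAt (fun q : ℂ × ℂ => wpoly m α q.1 q.2) (z, p0) :=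
      (gw_wpoly_analytic m α hα (z, p0) ⟨mem_univ _, hp0⟩).continuousAt
    have hc' : ContinuousAt (fun q : ℂ × ℂ => wpoly m α q.2 q.1) (p0, z) :=
      ContinuousAt.comp' (f := fun q : ℂ × ℂ => (q.2, q.1)) (x := (p0, z)) hc (by fun_prop)
    exact hc'.eventually_ne (fun h => hz.2 (h0 z h))
  filter_upwards [hb, h2] with p hb h2 z hzD hz
  by_cases hzB : ‖z‖ ≤ B + 1
  · exact h2 z ⟨by simpa using hzB, hzD⟩ hz
  · push Not at hzB
    have hB0 : 0 ≤ B := Finset.sum_nonneg fun j _ => by positivity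
    have hz1 : 1 ≤ ‖z‖ := by linarith
    rcases Nat.eq_zero_or_pos m with rfl | hm
    · simp [wpoly] at hz
    have e : z ^ m = - ∑ j ∈ Finset.range m, α j p * z ^ j := eq_neg_of_add_eq_zero_left hz
    have : ‖z‖ ^ m ≤ B * ‖z‖ ^ (m - 1) := by
      rw [← norm_pow, e, norm_neg, hB, Finset.sum_mul]
      refine (norm_sum_le _ _).trans (Finset.sum_le_sum fun j hj => ?_)
      rw [norm_mul, norm_pow]
      have := hb j hj
      have hj' := Finset.mem_range.mp hj
      gcongr
      omega
    have e2 : ‖z‖ ^ m = ‖z‖ * ‖z‖ ^ (m - 1) := by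
      rw [← pow_succ']; congr 1; omega
    rw [e2] at this
    have := le_of_mul_le_mul_right this (by positivity)
    linarith

lemma gw_radius (S : Finset ℂ) {Ω : Set ℂ} (hΩ : IsOpen Ω) (hS : ∀ a ∈ S, a ∈ Ω) :
    ∃ ε : ℝ, 0 < ε ∧ (∀ a ∈ S, closedBall a ε ⊆ Ω) ∧
      ∀ a ∈ S, ∀ b ∈ S, a ≠ b → 2 * ε < dist a b := by
  have h1 : ∀ᶠ ε in 𝓝[>] (0 : ℝ), ∀ a ∈ S, closedBall a ε ⊆ Ω := by
    rw [Filter.eventually_all_finset]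
    intro a ha
    obtain ⟨r, hr, hrV⟩ := nhds_basis_closedBall.mem_iff.mp (hΩ.mem_nhds (hS a ha))
    filter_upwards [Ioo_mem_nhdsGT hr] with ε hε
    exact (closedBall_subset_closedBall hε.2.le).trans hrV
  have h2 : ∀ᶠ ε in 𝓝[>] (0 : ℝ), ∀ a ∈ S, ∀ b ∈ S, a ≠ b → 2 * ε < dist a b := by
    rw [Filter.eventually_all_finset]
    intro a ha
    rw [Filter.eventually_all_finset]
    intro b hb
    by_cases hab : a = b
    · simp [hab]
    · have : 0 < dist a b / 2 := half_pos (dist_pos.mpr hab)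
      filter_upwards [Ioo_mem_nhdsGT this] with ε hε _
      linarith [hε.2]
  obtain ⟨ε, h⟩ := (h1.and (h2.and self_mem_nhdsWithin)).exists
  exact ⟨ε, h.2.2, h.1, h.2.1⟩

/-- The averaged contour integral as a continuous linear functional. -/
lemma gw_J {T : Set ℂ} [CompactSpace T] (S : Finset ℂ) {ε : ℝ} (hε : 0 ≤ ε)
    (h : ∀ a ∈ S, sphere a ε ⊆ T) :
    ∃ J : C(T, ℂ) →L[ℂ] ℂ, ∀ (k : C(T, ℂ)) (φ : ℂ → ℂ), (∀ ζ : T, k ζ = φ ζ) →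
      J k = ∑ a ∈ S, (2 * Real.pi * Complex.I : ℂ)⁻¹ • ∮ ζ in C(a, ε), φ ζ := by
  have := fun a (ha : a ∈ S) => gw_int a hε (h a ha)
  choose! L hL using this
  refine ⟨∑ a ∈ S, (2 * Real.pi * Complex.I : ℂ)⁻¹ • L a, fun k φ hk => ?_⟩
  rw [_root_.sum_apply]
  refine Finset.sum_congr rfl fun a ha => ?_
  rw [_root_.smul_apply, hL a ha k φ hk]

lemma gw_cauchy {Ω : Set ℂ} (S : Finset ℂ) {ε : ℝ} (hε : 0 < ε)
    (h1 : ∀ a ∈ S, closedBall a ε ⊆ Ω) (h2 : ∀ a ∈ S, ∀ b ∈ S, a ≠ b → 2 * ε < dist a b)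
    (φ : ℂ → ℂ) (hφ : DifferentiableOn ℂ φ Ω) {z a : ℂ} (ha : a ∈ S) (hz : z ∈ ball a ε) :
    ∑ b ∈ S, (2 * Real.pi * Complex.I : ℂ)⁻¹ • ∮ ζ in C(b, ε), (ζ - z)⁻¹ * φ ζ = φ z := by
  rw [Finset.sum_eq_single_of_mem a ha]
  · have : DiffContOnCl ℂ φ (ball a ε) :=
      (hφ.mono (closure_ball_subset_closedBall.trans (h1 a ha))).diffContOnCl
    exact this.two_pi_i_inv_smul_circleIntegral_sub_inv_smul hz
  · intro b hb hba
    have hzb : z ∉ closedBall b ε := by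
      intro hzb
      have := h2 b hb a ha hba
      have t := dist_triangle_left b a z
      rw [mem_closedBall] at hzb
      rw [mem_ball] at hz
      linarith
    have : DifferentiableOn ℂ (fun ζ => (ζ - z)⁻¹ * φ ζ) (closedBall b ε) := by
      refine DifferentiableOn.fun_mul ?_ (hφ.mono (h1 b hb))
      refine DifferentiableOn.fun_inv (by fun_prop) ?_
      intro x hx h0
      rw [sub_eq_zero] at h0
      exact hzb (h0 ▸ hx)
    rw [DiffContOnCl.circleIntegral_eq_zero hε.le
      (this.mono closure_ball_subset_closedBall).diffContOnCl, smul_zero]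

lemma gw_unique_p (m : ℕ) (α : ℕ → ℂ → ℂ) {Ω : Set ℂ} (hΩ : IsOpen Ω) (p : ℂ)
    (hroots : ∀ z : ℂ, wpoly m α z p = 0 → z ∈ Ω) (g g' r r' : ℂ → ℂ)
    (hg : ContinuousOn g Ω) (hg' : ContinuousOn g' Ω) (hr : PolyDegLt r m) (hr' : PolyDegLt r' m)
    (h : ∀ z ∈ Ω, g z * wpoly m α z p + r z = g' z * wpoly m α z p + r' z) :
    ∀ z ∈ Ω, g z = g' z ∧ r z = r' z := by
  obtain ⟨Q, hQm, hcard, hprod, hev⟩ := gw_eval m α p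
  obtain ⟨q, hq, hqe⟩ := hr
  obtain ⟨q', hq', hqe'⟩ := hr'
  have hlt : (q' - q).degree < (m : WithBot ℕ) :=
    (Polynomial.degree_sub_le _ _).trans_lt (max_lt hq' hq)
  have := gw_unique hΩ Q.roots (by
    intro a ha
    apply hroots
    rw [← hev]
    exact (Polynomial.mem_roots'.mp ha).2) (fun z => g z - g' z) (hg.sub hg') (q' - q)
    (by rw [hcard]; exact hlt) (by
      intro z hz
      rw [hprod, hev, Polynomial.eval_sub, ← hqe, ← hqe']
      linear_combination - h z hz)
  intro z hz
  refine ⟨sub_eq_zero.mp (this.2 z hz), ?_⟩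
  rw [hqe, hqe', sub_eq_zero.mp this.1]

lemma gw_local (m : ℕ) (Ω Pdom : Set ℂ) (hΩo : IsOpen Ω) (hPo : IsOpen Pdom)
    (f : ℂ → ℂ → ℂ)
    (hf : AnalyticOnNhd ℂ (fun q : ℂ × ℂ => f q.1 q.2) (Ω ×ˢ Pdom))
    (α : ℕ → ℂ → ℂ)
    (hα : ∀ j < m, AnalyticOnNhd ℂ (α j) Pdom)
    (hroots : ∀ p ∈ Pdom, ∀ z : ℂ, wpoly m α z p = 0 → z ∈ Ω) (p0 : ℂ) (hp0 : p0 ∈ Pdom) :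
    ∃ (V : Set ℂ) (g r : ℂ → ℂ → ℂ), IsOpen V ∧ p0 ∈ V ∧ V ⊆ Pdom ∧
      AnalyticOnNhd ℂ (fun q : ℂ × ℂ => g q.1 q.2) (Ω ×ˢ V) ∧
      AnalyticOnNhd ℂ (fun q : ℂ × ℂ => r q.1 q.2) (Ω ×ˢ V) ∧
      (∀ p ∈ V, PolyDegLt (fun z => r z p) m) ∧
      (∀ z ∈ Ω, ∀ p ∈ V, f z p = g z p * wpoly m α z p + r z p) := by
  classical
  obtain ⟨Q, hQm, -, -, hev⟩ := gw_eval m α p0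
  set S : Finset ℂ := Q.roots.toFinset with hSdef
  have hS : ∀ z, z ∈ S ↔ wpoly m α z p0 = 0 := by
    intro z
    rw [hSdef, Multiset.mem_toFinset, Polynomial.mem_roots hQm.ne_zero, Polynomial.IsRoot, hev]
  obtain ⟨ε, hε, hεΩ, hεS⟩ := gw_radius S hΩo (fun a ha => hroots p0 hp0 a ((hS a).mp ha))
  set D : Set ℂ := ⋃ a ∈ S, ball a ε with hDdef
  have hDo : IsOpen D := isOpen_biUnion fun a _ => isOpen_ball
  have hmemD : ∀ z, z ∈ D ↔ ∃ a ∈ S, z ∈ ball a ε := by intro z; simp [hDdef]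
  set T : Set ℂ := ⋃ a ∈ S, sphere a ε with hTdef
  have hmemT : ∀ z, z ∈ T ↔ ∃ a ∈ S, z ∈ sphere a ε := by intro z; simp [hTdef]
  have hTc : IsCompact T := S.finite_toSet.isCompact_biUnion fun a _ => isCompact_sphere a ε
  haveI : CompactSpace T := isCompact_iff_compactSpace.mp hTc
  have hTD : ∀ z ∈ T, z ∉ D := by
    intro z hzT hzD
    obtain ⟨a, ha, hza⟩ := (hmemT z).mp hzT
    obtain ⟨b, hb, hzb⟩ := (hmemD z).mp hzD
    rw [mem_sphere] at hza
    rw [mem_ball] at hzb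
    by_cases hab : a = b
    · subst hab; linarith
    · have := hεS a ha b hb hab
      have := dist_triangle_left a b z
      linarith
  have hTΩ : T ⊆ Ω := by
    intro z hz
    obtain ⟨a, ha, hza⟩ := (hmemT z).mp hz
    exact hεΩ a ha (sphere_subset_closedBall hza)
  have hDΩ : D ⊆ Ω := by
    intro z hz
    obtain ⟨a, ha, hza⟩ := (hmemD z).mp hz
    exact hεΩ a ha (ball_subset_closedBall hza)
  have hnv := gw_nonvanish m α hPo hα hDo hp0 (fun z hz => (hmemD z).mpr
    ⟨z, (hS z).mpr hz, mem_ball_self hε⟩)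
  obtain ⟨V, hV, hVo, hpV⟩ := _root_.eventually_nhds_iff.mp (hnv.and (hPo.mem_nhds hp0))
  have hVP : V ⊆ Pdom := fun p hp => (hV p hp).2
  have hVn : ∀ p ∈ V, ∀ z, z ∉ D → wpoly m α z p ≠ 0 := fun p hp => (hV p hp).1
  have hu := gw_wpoly_analytic m α hα
  -- the quotient `f / u` on the contour
  have hquot : ∀ z ∈ Ω, ∀ p ∈ V, z ∉ D →
      AnalyticAt ℂ (fun q : ℂ × ℂ => f q.1 q.2 / wpoly m α q.1 q.2) (z, p) := by
    intro z hz p hp hzD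
    exact (hf (z, p) ⟨hz, hVP hp⟩).fun_div (hu (z, p) ⟨mem_univ _, hVP hp⟩) (hVn p hp z hzD)
  obtain ⟨A, hA, hAan⟩ := gw_param (S := T) hVo (fun z p => f z p / wpoly m α z p)
    (by
      intro q hq
      exact (hquot q.1 (hTΩ hq.1) q.2 hq.2 (hTD _ hq.1)).continuousAt.continuousWithinAt)
    (by
      intro ζ hζ p hp
      have h1 := hquot ζ (hTΩ hζ) p hp (hTD _ hζ)
      have h2 : AnalyticAt ℂ (fun p : ℂ => (ζ, p)) p := analyticAt_const.prod analyticAt_id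
      exact (AnalyticAt.fun_comp (f := fun p : ℂ => (ζ, p)) h1 h2).differentiableAt.differentiableWithinAt)
  obtain ⟨K, hK, hKan⟩ := gw_param (S := T) (V := Tᶜ) hTc.isClosed.isOpen_compl
    (fun ζ z => (ζ - z)⁻¹)
    (by
      refine ContinuousOn.inv₀ (by fun_prop) ?_
      intro q hq h0
      rw [sub_eq_zero] at h0
      exact hq.2 (h0 ▸ hq.1))
    (by
      intro ζ hζ
      refine DifferentiableOn.fun_inv (by fun_prop) ?_
      intro z hz h0
      rw [sub_eq_zero] at h0
      exact hz (h0 ▸ hζ))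
  obtain ⟨J, hJ⟩ := gw_J (T := T) S hε.le (fun a ha z hz => (hmemT z).mpr ⟨a, ha, hz⟩)
  let Z : C(T, ℂ) := ⟨fun ζ => ζ, continuous_subtype_val⟩
  let M : ℕ → ℂ → ℂ := fun i p => J (Z ^ i * A p)
  have hM : ∀ i, AnalyticOnNhd ℂ (M i) V := by
    intro i p hp
    exact (J.analyticAt _).fun_comp (analyticAt_const.fun_mul (hAan p hp))
  let W : ℕ → ℂ → ℂ → ℂ := fun n z p => ∑ i ∈ Finset.range n, M i p * z ^ (n - 1 - i)
  have hW : ∀ n, AnalyticOnNhd ℂ (fun q : ℂ × ℂ => W n q.1 q.2) (univ ×ˢ V) := by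
    intro n q hq
    refine Finset.analyticAt_fun_sum _ fun i _ => ?_
    exact ((hM i q.2 hq.2).fun_comp analyticAt_snd).fun_mul (analyticAt_fst.fun_pow _)
  let r : ℂ → ℂ → ℂ := fun z p => W m z p + ∑ j ∈ Finset.range m, α j p * W j z p
  have hr : AnalyticOnNhd ℂ (fun q : ℂ × ℂ => r q.1 q.2) (univ ×ˢ V) := by
    intro q hq
    refine (hW m q hq).fun_add (Finset.analyticAt_fun_sum _ fun j hj => ?_)
    exact ((hα j (Finset.mem_range.mp hj) q.2 (hVP hq.2)).fun_comp analyticAt_snd).fun_mul (hW j q hq)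
  have hrpoly : ∀ p, PolyDegLt (fun z => r z p) m := by
    intro p
    let w : ℕ → Polynomial ℂ := fun n =>
      ∑ i ∈ Finset.range n, Polynomial.C (M i p) * Polynomial.X ^ (n - 1 - i)
    have hw : ∀ n ≤ m, w n ∈ Polynomial.degreeLT ℂ m := by
      intro n hn
      refine Submodule.sum_mem _ fun i hi => ?_
      rw [Polynomial.mem_degreeLT]
      refine (Polynomial.degree_C_mul_X_pow_le _ _).trans_lt ?_
      have := Finset.mem_range.mp hi
      have : n - 1 - i < m := by omega
      exact_mod_cast this
    refine ⟨w m + ∑ j ∈ Finset.range m, (α j p) • w j, ?_, ?_⟩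
    · rw [← Polynomial.mem_degreeLT]
      refine Submodule.add_mem _ (hw m le_rfl) (Submodule.sum_mem _ fun j hj => ?_)
      exact Submodule.smul_mem _ _ (hw j (Finset.mem_range.mp hj).le)
    · intro z
      simp [r, W, w, Polynomial.eval_finsetSum]
  let g0 : ℂ → ℂ → ℂ := fun z p => J (K z * A p)
  have hg0 : ∀ z ∈ D, ∀ p ∈ V, AnalyticAt ℂ (fun q : ℂ × ℂ => g0 q.1 q.2) (z, p) := by
    intro z hz p hp
    have h1 : AnalyticAt ℂ (fun q : ℂ × ℂ => K q.1) (z, p) :=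
      AnalyticAt.fun_comp (f := fun q : ℂ × ℂ => q.1) (x := (z, p))
        (hKan z (fun h => hTD z h hz)) analyticAt_fst
    have h2 : AnalyticAt ℂ (fun q : ℂ × ℂ => A q.2) (z, p) :=
      AnalyticAt.fun_comp (f := fun q : ℂ × ℂ => q.2) (x := (z, p)) (hAan p hp) analyticAt_snd
    exact (J.analyticAt _).fun_comp (h1.fun_mul h2)
  -- the division identity on the discs
  have hid : ∀ z ∈ D, ∀ p ∈ V, f z p = g0 z p * wpoly m α z p + r z p := by
    intro z hz p hp
    obtain ⟨a, ha, hza⟩ := (hmemD z).mp hz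
    have hzT : z ∈ Tᶜ := fun h => hTD z h hz
    have hφ : DifferentiableOn ℂ (fun ζ => f ζ p) Ω := by
      intro ζ hζ
      have h2 : AnalyticAt ℂ (fun ζ : ℂ => (ζ, p)) ζ := analyticAt_id.prod analyticAt_const
      exact (AnalyticAt.fun_comp (f := fun ζ : ℂ => (ζ, p)) (hf (ζ, p) ⟨hζ, hVP hp⟩)
        h2).differentiableAt.differentiableWithinAt
    have hc := gw_cauchy S hε hεΩ hεS (fun ζ => f ζ p) hφ ha hza
    let k : C(T, ℂ) := wpoly m α z p • (K z * A p) +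
      (∑ i ∈ Finset.range m, z ^ (m - 1 - i) • (Z ^ i * A p) +
       ∑ j ∈ Finset.range m, α j p • ∑ i ∈ Finset.range j, z ^ (j - 1 - i) • (Z ^ i * A p))
    have hJk := hJ k (fun ζ => (ζ - z)⁻¹ * f ζ p) (by
      intro ζ
      have hne : (ζ : ℂ) - z ≠ 0 := by
        intro h0
        rw [sub_eq_zero] at h0
        exact hzT (h0 ▸ ζ.2)
      have hun : wpoly m α ζ p ≠ 0 := hVn p hp ζ (hTD ζ ζ.2)
      have e1 : ∀ n, ∑ i ∈ Finset.range n, z ^ (n - 1 - i) * ((ζ : ℂ) ^ i * A p ζ)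
          = ((ζ : ℂ) ^ n - z ^ n) * (ζ - z)⁻¹ * A p ζ := by
        intro n
        rw [← geom_sum₂_mul, mul_inv_cancel_right₀ hne, Finset.sum_mul]
        exact Finset.sum_congr rfl fun i _ => by ring
      have e2 : k ζ = wpoly m α z p * ((ζ - z)⁻¹ * A p ζ) +
          (((ζ : ℂ) ^ m - z ^ m) * (ζ - z)⁻¹ * A p ζ +
          ∑ j ∈ Finset.range m, α j p * (((ζ : ℂ) ^ j - z ^ j) * (ζ - z)⁻¹ * A p ζ)) := by
        simp only [k, ContinuousMap.add_apply, ContinuousMap.smul_apply, ContinuousMap.mul_apply,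
          ContinuousMap.sum_apply, ContinuousMap.pow_apply, smul_eq_mul, hK z hzT]
        simp only [Z, ContinuousMap.coe_mk, e1]
      have e3 : ((ζ : ℂ) ^ m - z ^ m) * (ζ - z)⁻¹ * A p ζ +
          ∑ j ∈ Finset.range m, α j p * (((ζ : ℂ) ^ j - z ^ j) * (ζ - z)⁻¹ * A p ζ)
          = (wpoly m α ζ p - wpoly m α z p) * ((ζ - z)⁻¹ * A p ζ) := by
        have : ∑ j ∈ Finset.range m, α j p * (((ζ : ℂ) ^ j - z ^ j) * (ζ - z)⁻¹ * A p ζ)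
            = (∑ j ∈ Finset.range m, α j p * (ζ : ℂ) ^ j - ∑ j ∈ Finset.range m, α j p * z ^ j)
              * ((ζ - z)⁻¹ * A p ζ) := by
          rw [← Finset.sum_sub_distrib, Finset.sum_mul]
          exact Finset.sum_congr rfl fun i _ => by ring
        rw [this, wpoly, wpoly]
        ring
      rw [e2, e3, hA p hp]
      field_simp
      ring)
    rw [hc] at hJk
    rw [← hJk]
    simp only [k, map_add, map_smul, map_sum, smul_eq_mul, g0, r, W, M]
    rw [mul_comm (wpoly m α z p)]
    congr 2
    · exact Finset.sum_congr rfl fun i _ => by ring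
    · refine Finset.sum_congr rfl fun j _ => ?_
      congr 1
      exact Finset.sum_congr rfl fun i _ => by ring
  let g : ℂ → ℂ → ℂ := fun z p => if z ∈ D then g0 z p else (f z p - r z p) / wpoly m α z p
  refine ⟨V, g, r, hVo, hpV, hVP, ?_, fun q hq => hr q ⟨mem_univ _, hq.2⟩, fun p _ => hrpoly p, ?_⟩
  · rintro ⟨z, p⟩ ⟨hz, hp⟩
    simp only at hz hp
    by_cases hzD : z ∈ D
    · refine (hg0 z hzD p hp).congr ?_
      have : ∀ᶠ q : ℂ × ℂ in 𝓝 (z, p), q.1 ∈ D :=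
        continuous_fst.continuousAt.eventually_mem (hDo.mem_nhds hzD)
      filter_upwards [this] with q hq
      simp [g, hq]
    · have hun := hVn p hp z hzD
      have hua := hu (z, p) ⟨mem_univ _, hVP hp⟩
      have h1 : AnalyticAt ℂ (fun q : ℂ × ℂ => (f q.1 q.2 - r q.1 q.2) / wpoly m α q.1 q.2) (z, p) :=
        ((hf (z, p) ⟨hz, hVP hp⟩).fun_sub (hr (z, p) ⟨mem_univ _, hp⟩)).fun_div hua hun
      refine h1.congr ?_
      have h2 : ∀ᶠ q : ℂ × ℂ in 𝓝 (z, p), q.2 ∈ V :=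
        continuous_snd.continuousAt.eventually_mem (hVo.mem_nhds hp)
      filter_upwards [h2, hua.continuousAt.eventually_ne hun] with q hq hq2
      by_cases hqD : q.1 ∈ D
      · simp only [g, hqD, if_true]
        rw [hid q.1 hqD q.2 hq]
        field_simp
        ring
      · simp [g, hqD]
  · intro z hz p hp
    by_cases hzD : z ∈ D
    · simp only [g, hzD, if_true]
      exact hid z hzD p hp
    · simp only [g, hzD, if_false]
      rw [div_mul_cancel₀ _ (hVn p hp z hzD)]
      ring

lemma gw_slice {Ω V : Set ℂ} {g : ℂ → ℂ → ℂ}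
    (hg : AnalyticOnNhd ℂ (fun q : ℂ × ℂ => g q.1 q.2) (Ω ×ˢ V)) {p : ℂ} (hp : p ∈ V) :
    ContinuousOn (fun z => g z p) Ω :=
  hg.continuousOn.comp (f := fun z : ℂ => (z, p)) (by fun_prop) (fun _ hz => ⟨hz, hp⟩)

/-- **Global Weierstrass division** (Lemma B.9): if `f` is analytic on `Ω × Π` and
`u(z,p) = z^m + α_{m-1}(p) z^{m-1} + ⋯ + α_0(p)` has analytic coefficients on `Π` with all
roots of `u(·,p)` lying in `Ω` for every `p ∈ Π`, then `f = g·u + r` with unique `g, r`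
analytic on `Ω × Π`, where each `r(·,p)` is a polynomial of degree less than `m`. -/
theorem global_weierstrass_division
    (m : ℕ) (Ω Pdom : Set ℂ)
    (hΩo : IsOpen Ω) (hΩc : IsConnected Ω) (hPo : IsOpen Pdom) (hPc : IsConnected Pdom)
    (f : ℂ → ℂ → ℂ)
    (hf : AnalyticOnNhd ℂ (fun q : ℂ × ℂ => f q.1 q.2) (Ω ×ˢ Pdom))
    (α : ℕ → ℂ → ℂ)
    (hα : ∀ j < m, AnalyticOnNhd ℂ (α j) Pdom)
    (hroots : ∀ p ∈ Pdom, ∀ z : ℂ, wpoly m α z p = 0 → z ∈ Ω) :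
    ∃ g r : ℂ → ℂ → ℂ,
      AnalyticOnNhd ℂ (fun q : ℂ × ℂ => g q.1 q.2) (Ω ×ˢ Pdom) ∧
      AnalyticOnNhd ℂ (fun q : ℂ × ℂ => r q.1 q.2) (Ω ×ˢ Pdom) ∧
      (∀ p ∈ Pdom, PolyDegLt (fun z => r z p) m) ∧
      (∀ z ∈ Ω, ∀ p ∈ Pdom, f z p = g z p * wpoly m α z p + r z p) ∧
      ∀ g' r' : ℂ → ℂ → ℂ,
        AnalyticOnNhd ℂ (fun q : ℂ × ℂ => g' q.1 q.2) (Ω ×ˢ Pdom) →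
        AnalyticOnNhd ℂ (fun q : ℂ × ℂ => r' q.1 q.2) (Ω ×ˢ Pdom) →
        (∀ p ∈ Pdom, PolyDegLt (fun z => r' z p) m) →
        (∀ z ∈ Ω, ∀ p ∈ Pdom, f z p = g' z p * wpoly m α z p + r' z p) →
        ∀ z ∈ Ω, ∀ p ∈ Pdom, g z p = g' z p ∧ r z p = r' z p := by
  have hloc := gw_local m Ω Pdom hΩo hPo f hf α hα hroots
  choose! V G R hVo hpV hVP hG hR hpoly heq using hloc
  have hagree : ∀ p0 ∈ Pdom, ∀ p ∈ V p0, ∀ z ∈ Ω, G p z p = G p0 z p ∧ R p z p = R p0 z p := by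
    intro p0 hp0 p hp
    have hpP := hVP p0 hp0 hp
    refine gw_unique_p m α hΩo p (hroots p hpP) (fun z => G p z p) (fun z => G p0 z p)
      (fun z => R p z p) (fun z => R p0 z p) (gw_slice (hG p hpP) (hpV p hpP))
      (gw_slice (hG p0 hp0) hp) (hpoly p hpP p (hpV p hpP)) (hpoly p0 hp0 p hp) ?_
    intro z hz
    rw [← heq p hpP z hz p (hpV p hpP), ← heq p0 hp0 z hz p hp]
  have hnear : ∀ z ∈ Ω, ∀ p ∈ Pdom, ∀ᶠ q : ℂ × ℂ in 𝓝 (z, p), q.1 ∈ Ω ∧ q.2 ∈ V p := by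
    intro z hz p hp
    exact (continuous_fst.continuousAt.eventually_mem (hΩo.mem_nhds hz)).and
      (continuous_snd.continuousAt.eventually_mem ((hVo p hp).mem_nhds (hpV p hp)))
  have hGan : AnalyticOnNhd ℂ (fun q : ℂ × ℂ => G q.2 q.1 q.2) (Ω ×ˢ Pdom) := by
    rintro ⟨z, p⟩ ⟨hz, hp⟩
    refine (hG p hp (z, p) ⟨hz, hpV p hp⟩).congr ?_
    filter_upwards [hnear z hz p hp] with q hq
    exact (hagree p hp q.2 hq.2 q.1 hq.1).1.symm
  refine ⟨fun z p => G p z p, fun z p => R p z p, hGan, ?_, fun p hp => hpoly p hp p (hpV p hp),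
    fun z hz p hp => heq p hp z hz p (hpV p hp), ?_⟩
  · rintro ⟨z, p⟩ ⟨hz, hp⟩
    refine (hR p hp (z, p) ⟨hz, hpV p hp⟩).congr ?_
    filter_upwards [hnear z hz p hp] with q hq
    exact (hagree p hp q.2 hq.2 q.1 hq.1).2.symm
  · intro g' r' hg' _ hr' heq' z hz p hp
    refine gw_unique_p m α hΩo p (hroots p hp) (fun z => G p z p) (fun z => g' z p)
      (fun z => R p z p) (fun z => r' z p) (gw_slice (hG p hp) (hpV p hp))
      (gw_slice hg' hp) (hpoly p hp p (hpV p hp)) (hr' p hp) ?_ z hz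
    intro z hz
    rw [← heq p hp z hz p (hpV p hp), ← heq' z hz p hp]
end

section
/- Let Ω ⊆ ℂ be a domain and let T : ℂ → ℂ^{n×n} be analytic on Ω with det T not identically zero on Ω. Suppose the zero set of det T in Ω is finite, consisting of distinct points λ_1, …, λ_s whose orders of vanishing are a_1, …, a_s, and set m = a_1 + ⋯ + a_s. Then there exist matrices V, W ∈ ℂ^{n×m}, a matrix J ∈ ℂ^{m×m} that is upper triangular with diagonal entries consisting of each λ_i repeated a_i times consecutively, with each entry on the superdiagonal equal to 0 or 1 and all other off-diagonal entries equal to 0, and a function N : ℂ → ℂ^{n×n} analytic on Ω, such that T(z)^{-1} = V (z·I − J)^{-1} W^* + N(z) for every z ∈ Ω with det T(z) ≠ 0. -/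
open Matrix

/-- `g` has a zero of order `k` at `z₀`. -/
def ZeroOrder (g : ℂ → ℂ) (z₀ : ℂ) (k : ℕ) : Prop :=
  ∃ h : ℂ → ℂ, AnalyticAt ℂ h z₀ ∧ h z₀ ≠ 0 ∧ ∀ᶠ z in nhds z₀, g z = (z - z₀) ^ k * h z

section helpers

open Filter Topology


lemma taylor_aux {c : ℂ} (k : ℕ) : ∀ {f : ℂ → ℂ}, AnalyticAt ℂ f c → 
   ∃ (d : ℕ → ℂ) (r : ℂ → ℂ), AnalyticAt ℂ r c ∧ ∀ᶠ z in 𝓝 c, f z = ∑ p ∈ Finset.range k, d p * (z - c) ^ p + (z - c) ^ k * r z := by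
  induction k with
  | zero => intro f hf; exact ⟨0, f, hf, by simp⟩
  | succ k ih =>
    intro f hf
    obtain ⟨d, r, hr, h⟩ := ih hf
    have hr' : AnalyticAt ℂ (dslope r c) c := by
      obtain ⟨p, hp⟩ := hr
      exact hp.has_fpower_series_dslope_fslope.analyticAt
    refine ⟨fun p => if p = k then r c else d p, dslope r c, hr', ?_⟩
    filter_upwards [h] with z hz
    rw [hz, Finset.sum_range_succ]
    have e1 : ∑ p ∈ Finset.range k, (if p = k then r c else d p) * (z - c) ^ p = ∑ p ∈ Finset.range k, d p * (z - c) ^ p := by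
      apply Finset.sum_congr rfl
      intro p hp
      rw [if_neg (Finset.mem_range.1 hp).ne]
    have e2 : r z = r c + (z - c) * dslope r c z := by
      have := sub_smul_dslope r c z
      rw [smul_eq_mul] at this
      rw [this]; ring
    rw [e1, e2]; simp; ring

lemma scalar_aux {c : ℂ} (k : ℕ) {φ ψ : ℂ → ℂ} (d e : ℕ → ℂ) (r q : ℂ → ℂ) (hψ : AnalyticAt ℂ ψ c)
    (hr : AnalyticAt ℂ r c) (hq : AnalyticAt ℂ q c)
    (h1 : ∀ᶠ z in 𝓝 c, φ z = ∑ p ∈ Finset.range k, d p * (z - c) ^ p + (z - c) ^ k * r z)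
    (h2 : ∀ᶠ z in 𝓝 c, ψ z = ∑ p ∈ Finset.range k, e p * (z - c) ^ p + (z - c) ^ k * q z) :
    ∃ h : ℂ → ℂ, AnalyticAt ℂ h c ∧ ∀ᶠ z in 𝓝[≠] c, φ z * ((z - c) ^ k)⁻¹ * ψ z = 
      (∑ u ∈ Finset.range k, ∑ v ∈ Finset.range k, d u * (if u ≤ v then ((z - c) ^ (v - u + 1))⁻¹ else 0) * e (k - 1 - v)) + h z := by
  refine ⟨fun z => r z * ψ z + (∑ p ∈ Finset.range k, d p * (z - c) ^ p) * q z +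
     ∑ u ∈ Finset.range k, ∑ v ∈ Finset.range k, (if u ≤ v then 0 else d u * (z - c) ^ (u - v - 1) * e (k - 1 - v)), ?_, ?_⟩
  · have : AnalyticAt ℂ (fun z => ∑ p ∈ Finset.range k, d p * (z - c) ^ p) c := by
      apply Finset.analyticAt_fun_sum; intros; fun_prop
    refine ((hr.mul hψ).add (this.mul hq)).add ?_
    apply Finset.analyticAt_fun_sum; intros u _
    apply Finset.analyticAt_fun_sum; intros v _
    split_ifs <;> fun_prop
  · filter_upwards [h1.filter_mono nhdsWithin_le_nhds, h2.filter_mono nhdsWithin_le_nhds, self_mem_nhdsWithin] with z h1 h2 hz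
    have hz : z - c ≠ 0 := sub_ne_zero.2 hz
    have hk : (z - c) ^ k ≠ 0 := pow_ne_zero _ hz
    have key : (∑ p ∈ Finset.range k, d p * (z - c) ^ p) * ((z - c) ^ k)⁻¹ * (∑ p ∈ Finset.range k, e p * (z - c) ^ p)
       = (∑ u ∈ Finset.range k, ∑ v ∈ Finset.range k, d u * (if u ≤ v then ((z - c) ^ (v - u + 1))⁻¹ else 0) * e (k - 1 - v)) +
       ∑ u ∈ Finset.range k, ∑ v ∈ Finset.range k, (if u ≤ v then 0 else d u * (z - c) ^ (u - v - 1) * e (k - 1 - v)) := by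
      rw [← Finset.sum_range_reflect (fun p => e p * (z - c) ^ p), Finset.sum_mul, Finset.sum_mul, ← Finset.sum_add_distrib]
      refine Finset.sum_congr rfl fun u hu => ?_
      rw [Finset.mul_sum, ← Finset.sum_add_distrib]
      refine Finset.sum_congr rfl fun v hv => ?_
      rw [Finset.mem_range] at hu hv
      split_ifs with huv
      · have : (z - c) ^ k = (z - c) ^ u * (z - c) ^ (k - 1 - v) * (z - c) ^ (v - u + 1) := by
          rw [← pow_add, ← pow_add]; congr 1; omega
        rw [this]; field_simp; ring
      · have : (z - c) ^ u * (z - c) ^ (k - 1 - v) = (z - c) ^ (u - v - 1) * (z - c) ^ k := by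
          rw [← pow_add, ← pow_add]; congr 1; omega
        field_simp
        linear_combination (d u * e (k - 1 - v)) * this
    have : φ z * ((z - c) ^ k)⁻¹ * ψ z = (∑ p ∈ Finset.range k, d p * (z - c) ^ p) * ((z - c) ^ k)⁻¹ * (∑ p ∈ Finset.range k, e p * (z - c) ^ p) + (r z * ψ z + (∑ p ∈ Finset.range k, d p * (z - c) ^ p) * q z) := by
      rw [h1, h2]; field_simp; ring
    rw [this, key]; ring

lemma ext_aux (Ω : Set ℂ) (g : ℂ → ℂ)
    (hg : ∀ z ∈ Ω, ∃ h : ℂ → ℂ, AnalyticAt ℂ h z ∧ ∀ᶠ w in 𝓝[≠] z, g w = h w) :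
    ∃ N : ℂ → ℂ, AnalyticOnNhd ℂ N Ω ∧ ∀ z ∈ Ω, AnalyticAt ℂ g z → N z = g z := by
  have lim_eq : ∀ (z : ℂ) (h : ℂ → ℂ), AnalyticAt ℂ h z → (∀ᶠ w in 𝓝[≠] z, g w = h w) →
      limUnder (𝓝[≠] z) g = h z := by
    intro z h hh he
    apply Tendsto.limUnder_eq
    have := hh.continuousAt.tendsto.mono_left (nhdsWithin_le_nhds (s := {z}ᶜ))
    exact this.congr' (he.mono fun _ h => h.symm)
  refine ⟨fun z => limUnder (𝓝[≠] z) g, ?_, ?_⟩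
  · intro z hz
    obtain ⟨h, hh, he⟩ := hg z hz
    refine hh.congr ?_
    have e1 := eventually_eventually_nhdsWithin.2 he
    rw [eventually_nhdsWithin_iff] at e1
    filter_upwards [hh.eventually_analyticAt, e1] with w hw h1
    by_cases hwz : w = z
    · subst hwz; exact (lim_eq _ _ hh he).symm
    · refine (lim_eq _ _ hw ?_).symm
      have h2 := h1 hwz
      have h3 : ∀ᶠ y in 𝓝 w, g y = h y := by
        rwa [isOpen_compl_singleton.nhdsWithin_eq hwz] at h2
      exact h3.filter_mono nhdsWithin_le_nhds
  · intro z hz hgz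
    exact lim_eq z g hgz (Eventually.of_forall fun _ => rfl)
/-- Entrywise analyticity of a matrix-valued function at a point. -/
def MatAn {ι κ : Type} (c : ℂ) (A : ℂ → Matrix ι κ ℂ) : Prop :=
  ∀ i j, AnalyticAt ℂ (fun z => A z i j) c

lemma MatAn.mul {ι κ τ : Type} [Fintype κ] {c : ℂ} {A : ℂ → Matrix ι κ ℂ} {B : ℂ → Matrix κ τ ℂ}
    (hA : MatAn c A) (hB : MatAn c B) : MatAn c (fun z => A z * B z) := by
  intro i j
  simp only [Matrix.mul_apply]
  apply Finset.analyticAt_fun_sum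
  intro x _
  exact (hA i x).mul (hB x j)

lemma MatAn.fromBlocks {ι κ τ μ : Type} {c : ℂ} {A : ℂ → Matrix ι κ ℂ} {B : ℂ → Matrix ι τ ℂ}
    {C : ℂ → Matrix μ κ ℂ} {D : ℂ → Matrix μ τ ℂ}
    (hA : MatAn c A) (hB : MatAn c B) (hC : MatAn c C) (hD : MatAn c D) :
    MatAn c (fun z => Matrix.fromBlocks (A z) (B z) (C z) (D z)) := by
  rintro (i | i) (j | j)
  · exact hA i j
  · exact hB i j
  · exact hC i j
  · exact hD i j

lemma MatAn.const {ι κ : Type} {c : ℂ} (A : Matrix ι κ ℂ) : MatAn c (fun _ => A) :=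
  fun _ _ => analyticAt_const

lemma MatAn.det {c : ℂ} {n : ℕ} {A : ℂ → Matrix (Fin n) (Fin n) ℂ} (hA : MatAn c A) :
    AnalyticAt ℂ (fun z => (A z).det) c := by
  simp only [Matrix.det_apply']
  apply Finset.analyticAt_fun_sum
  intro σ _
  refine analyticAt_const.mul ?_
  apply Finset.analyticAt_fun_prod
  intro i _
  exact hA _ _

lemma MatAn.inv {c : ℂ} {n : ℕ} {A : ℂ → Matrix (Fin n) (Fin n) ℂ} (hA : MatAn c A)
    (hu : IsUnit (A c)) : MatAn c (fun z => (A z)⁻¹) := by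
  intro i j
  rw [Matrix.isUnit_iff_isUnit_det, isUnit_iff_ne_zero] at hu
  simp only [Matrix.inv_def, Ring.inverse_eq_inv', Matrix.smul_apply, smul_eq_mul,
    Matrix.adjugate_apply]
  refine (hA.det.inv hu).mul (MatAn.det ?_)
  intro x y
  by_cases hx : x = j
  · subst hx; simpa using analyticAt_const
  · simpa [Matrix.updateRow_ne hx] using hA x y

lemma smith_aux {c : ℂ} (n : ℕ) : ∀ T : ℂ → Matrix (Fin n) (Fin n) ℂ, MatAn c T →
    (∃ᶠ z in 𝓝 c, IsUnit (T z)) →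
    ∃ (k : Fin n → ℕ) (E F : ℂ → Matrix (Fin n) (Fin n) ℂ), MatAn c E ∧ MatAn c F ∧
      IsUnit (E c) ∧ IsUnit (F c) ∧
      ∀ᶠ z in 𝓝 c, T z = E z * diagonal (fun j => (z - c) ^ k j) * F z := by
  induction n with
  | zero =>
    intro T hT _
    exact ⟨0, fun _ => 1, fun _ => 1, MatAn.const _, MatAn.const _, isUnit_one, isUnit_one,
      Eventually.of_forall fun z => by ext i; exact i.elim0⟩
  | succ n ih =>
    intro T hT hU
    obtain ⟨⟨p, q⟩, hpq⟩ := Finite.exists_min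
      (fun x : Fin (n+1) × Fin (n+1) => analyticOrderAt (fun z => T z x.1 x.2) c)
    have hfin : analyticOrderAt (fun z => T z p q) c ≠ ⊤ := by
      intro htop
      have h0 : ∀ i j, ∀ᶠ z in 𝓝 c, T z i j = 0 := by
        intro i j
        have := hpq (i, j)
        simp only [htop, top_le_iff] at this
        exact analyticOrderAt_eq_top.1 this
      have h1 : ∀ᶠ z in 𝓝 c, ∀ i j, T z i j = 0 :=
        eventually_all.2 fun i => eventually_all.2 fun j => h0 i j
      obtain ⟨z, hz1, hz2⟩ := (hU.and_eventually h1).exists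
      have : T z = 0 := by ext i j; exact hz2 i j
      rw [this] at hz1
      exact not_isUnit_zero hz1
    obtain ⟨k, hk⟩ := ENat.ne_top_iff_exists.1 hfin
    have hg : ∀ i j, ∃ g : ℂ → ℂ, AnalyticAt ℂ g c ∧ (∀ᶠ z in 𝓝 c, T z i j = (z - c) ^ k * g z) ∧
        (i = p → j = q → g c ≠ 0) := by
      intro i j
      by_cases h : i = p ∧ j = q
      · obtain ⟨rfl, rfl⟩ := h
        obtain ⟨g, hg, hg0, he⟩ := (hT i j).analyticOrderAt_eq_natCast.1 hk.symm
        exact ⟨g, hg, he, fun _ _ => hg0⟩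
      · have := hpq (i, j)
        simp only [← hk] at this
        obtain ⟨g, hg, he⟩ := (natCast_le_analyticOrderAt (hT i j)).1 this
        exact ⟨g, hg, he, fun h1 h2 => absurd ⟨h1, h2⟩ h⟩
    choose g hga hge hg0 using hg
    have hge' : ∀ᶠ z in 𝓝 c, ∀ i j, T z i j = (z - c) ^ k * g i j z :=
      eventually_all.2 fun i => eventually_all.2 fun j => hge i j
    obtain ⟨e0⟩ : Nonempty (Fin n ⊕ Unit ≃ Fin (n + 1)) := ⟨Fintype.equivOfCardEq (by simp)⟩
    obtain ⟨e1, he1⟩ : ∃ e : Fin n ⊕ Unit ≃ Fin (n + 1), e (Sum.inr ()) = p :=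
      ⟨e0.trans (Equiv.swap (e0 (Sum.inr ())) p), by simp⟩
    obtain ⟨e2, he2⟩ : ∃ e : Fin n ⊕ Unit ≃ Fin (n + 1), e (Sum.inr ()) = q :=
      ⟨e0.trans (Equiv.swap (e0 (Sum.inr ())) q), by simp⟩
    have hu0 : g p q c ≠ 0 := hg0 p q rfl rfl
    have hue : ∀ᶠ z in 𝓝 c, g p q z ≠ 0 := (hga p q).continuousAt.eventually_ne hu0
    let A : ℂ → Matrix (Fin n) (Fin n) ℂ := fun z => Matrix.of fun i j =>
      (z - c) ^ k * (g (e1 (Sum.inl i)) (e2 (Sum.inl j)) z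
        - g (e1 (Sum.inl i)) q z * (g p q z)⁻¹ * g p (e2 (Sum.inl j)) z)
    let L : ℂ → Matrix (Fin n ⊕ Unit) (Fin n ⊕ Unit) ℂ := fun z =>
      Matrix.fromBlocks 1 (Matrix.of fun i _ => g (e1 (Sum.inl i)) q z * (g p q z)⁻¹) 0 1
    let U : ℂ → Matrix (Fin n ⊕ Unit) (Fin n ⊕ Unit) ℂ := fun z =>
      Matrix.fromBlocks 1 0 (Matrix.of fun _ j => g p (e2 (Sum.inl j)) z) (Matrix.of fun _ _ => g p q z)
    have hA : MatAn c A := by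
      intro i j
      have h1 := (hga p q).inv hu0
      exact (AnalyticAt.pow (by fun_prop) k).mul
        ((hga _ _).sub (((hga _ _).mul h1).mul (hga _ _)))
    have hL : MatAn c L := by
      refine MatAn.fromBlocks (MatAn.const _) ?_ (MatAn.const _) (MatAn.const _)
      intro i j
      exact (hga _ _).mul ((hga p q).inv hu0)
    have hUa : MatAn c U := by
      refine MatAn.fromBlocks (MatAn.const _) (MatAn.const _) ?_ ?_
      · intro i j; exact hga _ _
      · intro i j; exact hga _ _
    have hLu : ∀ z, IsUnit (L z) := by
      intro z
      rw [Matrix.isUnit_iff_isUnit_det]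
      simp [L]
    have hUu : IsUnit (U c) := by
      rw [Matrix.isUnit_iff_isUnit_det]
      simp [U, hu0]
    have hfac : ∀ᶠ z in 𝓝 c, (T z).submatrix e1 e2 =
        L z * Matrix.fromBlocks (A z) 0 0 (Matrix.of fun _ _ => (z - c) ^ k) * U z := by
      filter_upwards [hge', hue] with z h1 h2
      ext i j
      rcases i with i | i <;> rcases j with j | j <;>
        simp [L, U, Matrix.fromBlocks_multiply, h1, he1, he2] <;>
        simp [A, Matrix.mul_apply] <;> field_simp <;> ring
    have hAU : ∃ᶠ z in 𝓝 c, IsUnit (A z) := by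
      refine (hU.and_eventually hfac).mono ?_
      rintro z ⟨h1, h2⟩
      have h3 : IsUnit ((T z).submatrix e1 e2) := (Matrix.isUnit_submatrix_equiv e1 e2).2 h1
      rw [h2, Matrix.isUnit_iff_isUnit_det, Matrix.det_mul, Matrix.det_mul,
        isUnit_iff_ne_zero] at h3
      rw [Matrix.isUnit_iff_isUnit_det, isUnit_iff_ne_zero]
      intro h
      exact h3 (by rw [Matrix.det_fromBlocks_zero₂₁ (A z), h]; ring)
    obtain ⟨k', E', F', hE', hF', hE'u, hF'u, he⟩ := ih A hA hAU
    let E : ℂ → Matrix (Fin n ⊕ Unit) (Fin n ⊕ Unit) ℂ := fun z =>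
      L z * Matrix.fromBlocks (E' z) 0 0 1
    let F : ℂ → Matrix (Fin n ⊕ Unit) (Fin n ⊕ Unit) ℂ := fun z =>
      Matrix.fromBlocks (F' z) 0 0 1 * U z
    have hE : MatAn c E :=
      hL.mul (MatAn.fromBlocks hE' (MatAn.const _) (MatAn.const _) (MatAn.const _))
    have hF : MatAn c F :=
      (MatAn.fromBlocks hF' (MatAn.const _) (MatAn.const _) (MatAn.const _)).mul hUa
    have hEu : IsUnit (E c) := (hLu c).mul (by
      rw [Matrix.isUnit_iff_isUnit_det] at hE'u ⊢; simpa using hE'u)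
    have hFu : IsUnit (F c) := IsUnit.mul (by
      rw [Matrix.isUnit_iff_isUnit_det] at hF'u ⊢; simpa using hF'u) hUu
    refine ⟨fun i => Sum.elim k' (fun _ => k) (e1.symm i),
      fun z => (E z).submatrix e1.symm e1.symm, fun z => (F z).submatrix e1.symm e2.symm,
      fun i j => hE _ _, fun i j => hF _ _, (Matrix.isUnit_submatrix_equiv _ _).2 hEu,
      (Matrix.isUnit_submatrix_equiv _ _).2 hFu, ?_⟩
    filter_upwards [hfac, he] with z h1 h2
    have h3 : (T z).submatrix e1 e2 =
        E z * diagonal (fun j => (z - c) ^ (Sum.elim k' (fun _ => k) j : ℕ)) * F z := by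
      rw [h1]
      have : Matrix.fromBlocks (A z) 0 0 (Matrix.of fun (_ _ : Unit) => (z - c) ^ k) =
          Matrix.fromBlocks (E' z) 0 0 1 *
          diagonal (fun j => (z - c) ^ (Sum.elim k' (fun _ => k) j : ℕ)) *
          Matrix.fromBlocks (F' z) 0 0 1 := by
        have hd : diagonal (fun j => (z - c) ^ (Sum.elim k' (fun (_ : Unit) => k) j : ℕ)) =
          Matrix.fromBlocks (diagonal fun j => (z - c) ^ k' j) 0 0
            (Matrix.of fun (_ _ : Unit) => (z - c) ^ k) := by
          ext i j
          rcases i with i | i <;> rcases j with j | j <;> simp [Matrix.diagonal_apply]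
        rw [hd]
        simp [Matrix.fromBlocks_multiply, h2]
      rw [this]
      simp only [E, F, Matrix.mul_assoc]
    have h4 : T z = ((T z).submatrix e1 e2).submatrix e1.symm e2.symm := by simp
    rw [h4, h3]
    rw [← Matrix.submatrix_mul_equiv _ _ e1.symm e1.symm e2.symm,
      ← Matrix.submatrix_mul_equiv _ _ e1.symm e1.symm e1.symm,
      Matrix.submatrix_diagonal_equiv]
    rfl

lemma local_aux {c : ℂ} (n a : ℕ) (T : ℂ → Matrix (Fin n) (Fin n) ℂ) (hT : MatAn c T)
    (h : ZeroOrder (fun z => (T z).det) c a) :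
    ∃ (k : Fin n → ℕ) (V W : Fin n → Fin n → ℕ → ℂ), ∑ j, k j = a ∧
      ∀ i l, ∃ h : ℂ → ℂ, AnalyticAt ℂ h c ∧ ∀ᶠ z in 𝓝[≠] c, (T z)⁻¹ i l =
        (∑ j, ∑ u ∈ Finset.range (k j), ∑ v ∈ Finset.range (k j),
          V i j u * (if u ≤ v then ((z - c) ^ (v - u + 1))⁻¹ else 0) * W l j v) + h z := by
  obtain ⟨d, hd, hd0, hde⟩ := h
  have hde0 : ∀ᶠ z in 𝓝 c, d z ≠ 0 := hd.continuousAt.eventually_ne hd0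
  have hTu : ∀ᶠ z in 𝓝[≠] c, IsUnit (T z) := by
    filter_upwards [hde.filter_mono nhdsWithin_le_nhds, hde0.filter_mono nhdsWithin_le_nhds,
      self_mem_nhdsWithin] with z h1 h2 h3
    rw [Matrix.isUnit_iff_isUnit_det, isUnit_iff_ne_zero, h1]
    exact mul_ne_zero (pow_ne_zero _ (sub_ne_zero.2 h3)) h2
  obtain ⟨k, E, F, hE, hF, hEu, hFu, he⟩ := smith_aux n T hT
    (hTu.frequently.filter_mono nhdsWithin_le_nhds)
  have hdetE := MatAn.det hE
  have hdetF := MatAn.det hF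
  have hE0 : (E c).det ≠ 0 := by
    rwa [Matrix.isUnit_iff_isUnit_det, isUnit_iff_ne_zero] at hEu
  have hF0 : (F c).det ≠ 0 := by
    rwa [Matrix.isUnit_iff_isUnit_det, isUnit_iff_ne_zero] at hFu
  have hsum : ∑ j, k j = a := by
    have o1 : analyticOrderAt (fun z => (T z).det) c = a :=
      (MatAn.det hT).analyticOrderAt_eq_natCast.2 ⟨d, hd, hd0, hde⟩
    have o2 : analyticOrderAt (fun z => (T z).det) c = (∑ j, k j : ℕ) := by
      refine (MatAn.det hT).analyticOrderAt_eq_natCast.2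
        ⟨fun z => (E z).det * (F z).det, hdetE.mul hdetF, mul_ne_zero hE0 hF0, ?_⟩
      filter_upwards [he] with z hz
      rw [hz, Matrix.det_mul, Matrix.det_mul, Matrix.det_diagonal, Finset.prod_pow_eq_pow_sum,
        smul_eq_mul]
      ring
    rw [o1] at o2
    exact_mod_cast o2.symm
  have hEi := MatAn.inv hE hEu
  have hFi := MatAn.inv hF hFu
  choose dF rF hrF hF' using fun i j => taylor_aux (k j) (hFi i j)
  choose dE rE hrE hE' using fun l j => taylor_aux (k j) (hEi j l)
  refine ⟨k, dF, fun l j v => dE l j (k j - 1 - v), hsum, ?_⟩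
  intro i l
  choose h hh hhe using fun j => scalar_aux (k j) (dF i j) (dE l j) (rF i j) (rE l j) (hEi j l)
    (hrF i j) (hrE l j) (hF' i j) (hE' l j)
  refine ⟨fun z => ∑ j, h j z, ?_, ?_⟩
  · apply Finset.analyticAt_fun_sum; intro j _; exact hh j
  · filter_upwards [he.filter_mono nhdsWithin_le_nhds, eventually_all.2 hhe,
      self_mem_nhdsWithin] with z h1 h2 h3
    rw [← Finset.sum_add_distrib]
    simp only [← h2]
    rw [h1, Matrix.mul_inv_rev, Matrix.mul_inv_rev]
    have hdi : (diagonal fun j => (z - c) ^ k j)⁻¹ = diagonal fun j => ((z - c) ^ k j)⁻¹ := by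
      apply Matrix.inv_eq_left_inv
      rw [Matrix.diagonal_mul_diagonal, ← Matrix.diagonal_one]
      congr 1; ext j
      exact inv_mul_cancel₀ (pow_ne_zero _ (sub_ne_zero.2 h3))
    rw [hdi, ← Matrix.mul_assoc, Matrix.mul_apply]
    simp only [Matrix.mul_diagonal]

/-- A single Jordan block. -/
def jBlock (c : ℂ) (K : ℕ) : Matrix (Fin K) (Fin K) ℂ :=
  Matrix.of fun u v => if u = v then c else if (v : ℕ) = u + 1 then 1 else 0

/-- The resolvent of a single Jordan block. -/
noncomputable def rBlock (c : ℂ) (K : ℕ) (z : ℂ) : Matrix (Fin K) (Fin K) ℂ :=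
  Matrix.of fun u v => if (u : ℕ) ≤ v then ((z - c) ^ ((v : ℕ) - u + 1))⁻¹ else 0

lemma jBlock_mul (c : ℂ) (K : ℕ) (z : ℂ) (hz : z ≠ c) :
    (z • (1 : Matrix (Fin K) (Fin K) ℂ) - jBlock c K) * rBlock c K z = 1 := by
  have ht : z - c ≠ 0 := sub_ne_zero.2 hz
  ext u v
  rw [Matrix.mul_apply]
  have h1 : ∀ w : Fin K, (z • (1 : Matrix (Fin K) (Fin K) ℂ) - jBlock c K) u w * rBlock c K z w v
      = (if u = w then (z - c) * rBlock c K z w v else 0)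
        - (if (w : ℕ) = u + 1 then rBlock c K z w v else 0) := by
    intro w
    by_cases h : u = w
    · subst h; simp [jBlock]
    · simp [jBlock, h]
  simp only [h1, Finset.sum_sub_distrib, Finset.sum_ite_eq, Finset.mem_univ, if_true]
  have h2 : ∑ w : Fin K, (if (w : ℕ) = u + 1 then rBlock c K z w v else 0) =
      if (u : ℕ) + 1 ≤ v then ((z - c) ^ ((v : ℕ) - (u + 1) + 1))⁻¹ else 0 := by
    by_cases h : (u : ℕ) + 1 < K
    · rw [Finset.sum_eq_single ⟨u + 1, h⟩]
      · simp only [rBlock, Matrix.of_apply, if_true]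
      · intro w _ hw
        rw [if_neg]
        intro h'; exact hw (Fin.ext h')
      · simp
    · rw [Finset.sum_eq_zero, if_neg (by omega)]
      intro w _
      rw [if_neg (by omega)]
  rw [h2]
  simp only [rBlock, Matrix.of_apply, Matrix.one_apply]
  rcases lt_trichotomy (u : ℕ) (v : ℕ) with h | h | h
  · rw [if_pos h.le, if_pos (by omega), if_neg (fun h' => by subst h'; omega)]
    have : (v : ℕ) - (u + 1) + 1 = v - u := by omega
    rw [this, pow_succ]; field_simp; ring
  · have : u = v := Fin.ext h
    subst this
    simp [ht]
  · rw [if_neg (by omega), if_neg (by omega), if_neg (fun h' => by subst h'; omega)]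
    simp

lemma sigma_mono {S : ℕ} {K : Fin S → ℕ} (x y : (b : Fin S) × Fin (K b)) (h : x.1 < y.1) :
    finSigmaFinEquiv x < finSigmaFinEquiv y := by
  rw [Fin.lt_def, finSigmaFinEquiv_apply, finSigmaFinEquiv_apply]
  let Kt : ℕ → ℕ := fun i => if h : i < S then K ⟨i, h⟩ else 0
  have e : ∀ b : Fin S, ∑ i : Fin b, K (Fin.castLE b.2.le i) = ∑ i ∈ Finset.range b, Kt i := by
    intro b
    rw [Finset.sum_range]
    refine Finset.sum_congr rfl fun i _ => ?_
    have : (i : ℕ) < S := i.2.trans b.2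
    simp only [Kt, dif_pos this]
    rfl
  rw [e, e]
  have h1 : ∑ i ∈ Finset.range (x.1 + 1), Kt i ≤ ∑ i ∈ Finset.range y.1, Kt i :=
    Finset.sum_le_sum_of_subset (Finset.range_mono h)
  rw [Finset.sum_range_succ] at h1
  have h2 : Kt x.1 = K x.1 := by simp [Kt]
  have := x.2.2
  omega


end helpers

/-- **General Keldysh theorem, existence part** (Theorem A.1): for `T` analytic on a
domain `Ω` with finitely many eigenvalues `λ_1, …, λ_s` in `Ω` of algebraic multiplicities
`a_1, …, a_s` summing to `m`, there are `V, W ∈ ℂ^{n×m}`, a Jordan-type upper triangular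
matrix `J ∈ ℂ^{m×m}` whose diagonal consists of each `λ_i` repeated `a_i` times
consecutively, with superdiagonal entries in `{0,1}` and all other off-diagonal entries
zero, and an `N` analytic on `Ω`, with `T(z)⁻¹ = V (zI - J)⁻¹ W^* + N(z)`. -/
theorem general_keldysh_existence
    (n s m : ℕ) (Ω : Set ℂ) (hΩo : IsOpen Ω) (hΩc : IsConnected Ω)
    (T : ℂ → Matrix (Fin n) (Fin n) ℂ)
    (hT : ∀ i j, AnalyticOnNhd ℂ (fun z => T z i j) Ω)
    (hdet : ∃ z ∈ Ω, (T z).det ≠ 0)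
    (lam : Fin s → ℂ) (a : Fin s → ℕ)
    (hmem : ∀ i, lam i ∈ Ω) (hinj : Function.Injective lam)
    (hzeros : ∀ z ∈ Ω, (T z).det = 0 ↔ ∃ i, z = lam i)
    (horder : ∀ i, ZeroOrder (fun z => (T z).det) (lam i) (a i))
    (hm : m = ∑ i, a i) :
    ∃ (V W : Matrix (Fin n) (Fin m) ℂ) (J : Matrix (Fin m) (Fin m) ℂ)
      (σ : Fin m → Fin s),
      Monotone σ ∧
      (∀ i : Fin s, (Finset.univ.filter fun k => σ k = i).card = a i) ∧
      (∀ k : Fin m, J k k = lam (σ k)) ∧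
      (∀ k l : Fin m, (l : ℕ) = (k : ℕ) + 1 → (J k l = 0 ∨ J k l = 1)) ∧
      (∀ k l : Fin m, ((l : ℕ) < (k : ℕ) ∨ (k : ℕ) + 1 < (l : ℕ)) → J k l = 0) ∧
      ∃ N : ℂ → Matrix (Fin n) (Fin n) ℂ,
        (∀ i j, AnalyticOnNhd ℂ (fun z => N z i j) Ω) ∧
        ∀ z ∈ Ω, (T z).det ≠ 0 →
          (T z)⁻¹ = V * (z • (1 : Matrix (Fin m) (Fin m) ℂ) - J)⁻¹ * Wᴴ + N z := by
  have hTan : ∀ z ∈ Ω, MatAn z T := fun z hz i j => hT i j z hz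
  choose k V0 W0 hk hloc using fun i : Fin s =>
    local_aux n (a i) T (hTan _ (hmem i)) (horder i)
  let pr : Fin (s * n) → Fin s × Fin n := fun b => finProdFinEquiv.symm b
  let K : Fin (s * n) → ℕ := fun b => k (pr b).1 (pr b).2
  have hsumB : ∀ f : Fin s → Fin n → ℂ, ∑ b, f (pr b).1 (pr b).2 = ∑ i, ∑ j, f i j := by
    intro f
    rw [← Fintype.sum_prod_type' f]
    exact Equiv.sum_comp finProdFinEquiv.symm (fun x : Fin s × Fin n => f x.1 x.2)
  have hmK : m = ∑ b, K b := by
    rw [hm]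
    have : ∑ b, K b = ∑ i, ∑ j, k i j := by
      rw [← Fintype.sum_prod_type' k]
      exact Equiv.sum_comp finProdFinEquiv.symm (fun x : Fin s × Fin n => k x.1 x.2)
    rw [this]
    exact Finset.sum_congr rfl fun i _ => (hk i).symm
  clear hm
  subst hmK
  let eq : ((b : Fin (s * n)) × Fin (K b)) ≃ Fin (∑ b, K b) := finSigmaFinEquiv
  let J' : Matrix ((b : Fin (s * n)) × Fin (K b)) ((b : Fin (s * n)) × Fin (K b)) ℂ :=
    Matrix.blockDiagonal' fun b => jBlock (lam (pr b).1) (K b)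
  let R' : ℂ → Matrix ((b : Fin (s * n)) × Fin (K b)) ((b : Fin (s * n)) × Fin (K b)) ℂ :=
    fun z => Matrix.blockDiagonal' fun b => rBlock (lam (pr b).1) (K b) z
  let V' : Matrix (Fin n) ((b : Fin (s * n)) × Fin (K b)) ℂ :=
    Matrix.of fun i x => V0 (pr x.1).1 i (pr x.1).2 x.2
  let W' : Matrix (Fin n) ((b : Fin (s * n)) × Fin (K b)) ℂ :=
    Matrix.of fun l x => star (W0 (pr x.1).1 l (pr x.1).2 x.2)
  let P : Fin s → Fin n → Fin n → ℂ → ℂ := fun ι i l z =>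
    ∑ j, ∑ u ∈ Finset.range (k ι j), ∑ v ∈ Finset.range (k ι j),
          V0 ι i j u * (if u ≤ v then ((z - lam ι) ^ (v - u + 1))⁻¹ else 0) * W0 ι l j v
  have hPan : ∀ ι i l z, z ≠ lam ι → AnalyticAt ℂ (P ι i l) z := by
    intro ι i l z hz
    apply Finset.analyticAt_fun_sum; intro j _
    apply Finset.analyticAt_fun_sum; intro u _
    apply Finset.analyticAt_fun_sum; intro v _
    refine (analyticAt_const.mul ?_).mul analyticAt_const
    split_ifs
    · exact AnalyticAt.inv (by fun_prop) (pow_ne_zero _ (sub_ne_zero.2 hz))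
    · exact analyticAt_const
  have hVRW : ∀ z i l, (V' * R' z * W'ᴴ) i l = ∑ ι, P ι i l z := by
    intro z i l
    simp only [P]
    rw [← hsumB (fun ι j => ∑ u ∈ Finset.range (k ι j), ∑ v ∈ Finset.range (k ι j),
          V0 ι i j u * (if u ≤ v then ((z - lam ι) ^ (v - u + 1))⁻¹ else 0) * W0 ι l j v)]
    rw [Matrix.mul_apply, Fintype.sum_sigma]
    refine Finset.sum_congr rfl fun b _ => ?_
    rw [Finset.sum_comm, Finset.sum_range]
    refine Finset.sum_congr rfl fun v _ => ?_
    rw [Matrix.mul_apply, Fintype.sum_sigma, Finset.sum_eq_single b, Finset.sum_mul,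
      Finset.sum_range]
    · refine Finset.sum_congr rfl fun u _ => ?_
      simp only [R', Matrix.blockDiagonal'_apply_eq]
      simp [V', W', rBlock, Matrix.conjTranspose_apply]
    · intro b' _ hb
      refine Finset.sum_eq_zero fun u _ => ?_
      simp only [R', Matrix.blockDiagonal'_apply_ne _ _ _ hb, mul_zero]
    · simp
  have hres : ∀ z, (∀ ι, z ≠ lam ι) →
      (z • (1 : Matrix (Fin (∑ b, K b)) (Fin (∑ b, K b)) ℂ) - J'.submatrix eq.symm eq.symm)⁻¹
        = (R' z).submatrix eq.symm eq.symm := by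
    intro z hz
    apply Matrix.inv_eq_right_inv
    have h1 : (z • (1 : Matrix ((b : Fin (s * n)) × Fin (K b)) _ ℂ) - J') * R' z = 1 := by
      have : (z • (1 : Matrix ((b : Fin (s * n)) × Fin (K b)) _ ℂ) - J') =
          Matrix.blockDiagonal' fun b => z • (1 : Matrix (Fin (K b)) (Fin (K b)) ℂ)
            - jBlock (lam (pr b).1) (K b) := by
        have e1 := Matrix.blockDiagonal'_sub (fun b => z • (1 : Matrix (Fin (K b)) (Fin (K b)) ℂ))
          (fun b => jBlock (lam (pr b).1) (K b))
        have e2 := Matrix.blockDiagonal'_smul z (fun b => (1 : Matrix (Fin (K b)) (Fin (K b)) ℂ))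
        have e3 := Matrix.blockDiagonal'_one (α := ℂ) (m' := fun b => Fin (K b))
        simp only [J']
        rw [← e3]
        exact (congrArg (· - _) e2.symm).trans e1.symm
      rw [this]
      simp only [R']
      rw [← Matrix.blockDiagonal'_mul]
      have : (fun b => (z • (1 : Matrix (Fin (K b)) (Fin (K b)) ℂ)
            - jBlock (lam (pr b).1) (K b)) * rBlock (lam (pr b).1) (K b) z) = 1 := by
        funext b
        exact jBlock_mul _ _ _ (hz _)
      rw [this]
      exact Matrix.blockDiagonal'_one
    have h2 : (z • (1 : Matrix (Fin (∑ b, K b)) (Fin (∑ b, K b)) ℂ)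
        - J'.submatrix eq.symm eq.symm) =
        (z • (1 : Matrix ((b : Fin (s * n)) × Fin (K b)) _ ℂ) - J').submatrix eq.symm eq.symm := by
      rw [Matrix.submatrix_sub, Matrix.submatrix_smul]
      simp only [Pi.sub_apply, Pi.smul_apply, Matrix.submatrix_one_equiv]
    rw [h2, Matrix.submatrix_mul_equiv, h1, Matrix.submatrix_one_equiv]
  have hN : ∀ i l, ∃ N : ℂ → ℂ, AnalyticOnNhd ℂ N Ω ∧ ∀ z ∈ Ω, (T z).det ≠ 0 →
      N z = (T z)⁻¹ i l - ∑ ι, P ι i l z := by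
    intro i l
    have hreg : ∀ z ∈ Ω, (T z).det ≠ 0 →
        AnalyticAt ℂ (fun z => (T z)⁻¹ i l - ∑ ι, P ι i l z) z := by
      intro z hz hd
      have h1 : ∀ ι, z ≠ lam ι := fun ι h => hd ((hzeros z hz).2 ⟨ι, h⟩)
      refine ((hTan z hz).inv ?_ i l).sub ?_
      · rwa [Matrix.isUnit_iff_isUnit_det, isUnit_iff_ne_zero]
      · apply Finset.analyticAt_fun_sum; intro ι _; exact hPan ι i l z (h1 ι)
    obtain ⟨N, hN, hN'⟩ := ext_aux Ω (fun z => (T z)⁻¹ i l - ∑ ι, P ι i l z) (by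
      intro z hz
      by_cases hd : (T z).det = 0
      · obtain ⟨ι, rfl⟩ := (hzeros z hz).1 hd
        obtain ⟨h, hh, he⟩ := hloc ι i l
        refine ⟨fun z => h z - ∑ ι' ∈ Finset.univ.erase ι, P ι' i l z, hh.sub ?_, ?_⟩
        · apply Finset.analyticAt_fun_sum; intro ι' hι
          exact hPan ι' i l _ (fun h => (Finset.ne_of_mem_erase hι) (hinj h.symm))
        · filter_upwards [he] with w hw
          rw [hw, ← Finset.add_sum_erase _ _ (Finset.mem_univ ι)]
          simp only [P]; ring
      · exact ⟨_, hreg z hz hd, Filter.Eventually.of_forall fun _ => rfl⟩)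
    exact ⟨N, hN, fun z hz hd => hN' z hz (hreg z hz hd)⟩
  choose N hNa hNe using hN
  have heqv : ∀ x, ((eq x : Fin _) : ℕ) = _ := fun x => finSigmaFinEquiv_apply x
  refine ⟨V'.submatrix id eq.symm, W'.submatrix id eq.symm, J'.submatrix eq.symm eq.symm,
    fun x => (pr (eq.symm x).1).1, ?_, ?_, ?_, ?_, ?_, fun z => Matrix.of fun i l => N i l z,
    fun i j => hNa i j, ?_⟩
  · intro x y hxy
    have h1 : (eq.symm x).1 ≤ (eq.symm y).1 := by
      by_contra hlt
      have := sigma_mono _ _ (not_le.1 hlt)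
      change eq (eq.symm y) < eq (eq.symm x) at this
      simp only [Equiv.apply_symm_apply] at this
      exact absurd hxy (not_le.2 this)
    exact Fin.le_def.2 (Nat.div_le_div_right (Fin.le_def.1 h1))
  · intro ι
    rw [← hk ι, Finset.card_filter,
      Equiv.sum_comp eq.symm (fun x => if (pr x.1).1 = ι then 1 else 0), Fintype.sum_sigma]
    have h0 : ∀ b, (∑ _u : Fin (K b), (if (pr b).1 = ι then 1 else 0 : ℕ))
        = K b * (if (pr b).1 = ι then 1 else 0) := by
      intro b; simp
    have : ∑ b, K b * (if (pr b).1 = ι then 1 else 0)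
        = ∑ i, ∑ j, k i j * (if i = ι then 1 else 0) := by
      rw [← Fintype.sum_prod_type' (fun i j => k i j * (if i = ι then 1 else 0))]
      exact Equiv.sum_comp finProdFinEquiv.symm
        (fun x : Fin s × Fin n => k x.1 x.2 * (if x.1 = ι then 1 else 0))
    refine (Finset.sum_congr rfl fun b _ => h0 b).trans (this.trans ?_)
    rw [Finset.sum_eq_single ι]
    · simp
    · intro i _ hi; simp [hi]
    · simp
  · intro x
    simp only [Matrix.submatrix_apply, J']
    generalize eq.symm x = y
    obtain ⟨b, u⟩ := y
    rw [Matrix.blockDiagonal'_apply_eq]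
    simp [jBlock]
  · intro x y hxy
    obtain ⟨x, rfl⟩ := eq.surjective x
    obtain ⟨y, rfl⟩ := eq.surjective y
    simp only [Matrix.submatrix_apply, J', Equiv.symm_apply_apply]
    obtain ⟨b, u⟩ := x
    obtain ⟨b', v⟩ := y
    by_cases hb : b = b'
    · subst hb
      rw [Matrix.blockDiagonal'_apply_eq]
      by_cases huv : u = v
      · subst huv; omega
      · simp only [jBlock, Matrix.of_apply, if_neg huv]
        split_ifs <;> simp
    · left; exact Matrix.blockDiagonal'_apply_ne _ _ _ hb
  · intro x y hxy
    obtain ⟨x, rfl⟩ := eq.surjective x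
    obtain ⟨y, rfl⟩ := eq.surjective y
    simp only [Matrix.submatrix_apply, J', Equiv.symm_apply_apply]
    obtain ⟨b, u⟩ := x
    obtain ⟨b', v⟩ := y
    by_cases hb : b = b'
    · subst hb
      rw [Matrix.blockDiagonal'_apply_eq]
      rw [heqv, heqv] at hxy
      simp only at hxy
      simp only [jBlock, Matrix.of_apply]
      rw [if_neg, if_neg]
      · omega
      · rintro rfl; omega
    · exact Matrix.blockDiagonal'_apply_ne _ _ _ hb
  · intro z hz hd
    have h1 : ∀ ι, z ≠ lam ι := fun ι h => hd ((hzeros z hz).2 ⟨ι, h⟩)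
    rw [hres z h1, Matrix.submatrix_mul_equiv, Matrix.conjTranspose_submatrix,
      Matrix.submatrix_mul_equiv]
    ext i l
    simp only [Matrix.add_apply, Matrix.submatrix_apply, id, Matrix.of_apply]
    rw [hVRW, hNe i l z hz hd]
    ring
end
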